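/- arXiv:2212.14500 — 2 statements merged into one kernel-verified Lean document; each statement's English description precedes it below -/
import Mathlib

section
/- Let J = [t₀, t₀ + a] with a > 0, let g : J → ℝ be nondecreasing and left-continuous, and let f : J × ℝⁿ → ℝⁿ satisfy conditions (A0), (A1), (A2). For each regulated x : J → ℝⁿ the KS integral Bx(t) = ∫_{t₀}^{t} f(s, x(s)) dg(s) exists for every t ∈ J, and the family of functions {Bx : x ∈ G(J, ℝⁿ)} is uniformly bounded (namely ‖Bx(t)‖ ≤ ∫_{t₀}^{t₀+a} M(s) dg(s) for all t and x) and equiregulated; consequently, for any bounded set S ⊆ G(J, ℝⁿ), the set {Bx : x ∈ S} is relatively compact in G(J, ℝⁿ) with the sup norm. -/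
open Set Filter Topology

namespace HMDEPaper

/-- `ℝⁿ` with the Euclidean norm. -/
abbrev En (n : ℕ) := EuclideanSpace ℝ (Fin n)

section Defs

variable {E : Type*} [NormedAddCommGroup E]

/-- `f` is regulated on the interval `[a, b]`: one-sided limits exist at every point. -/
def RegulatedOn (f : ℝ → E) (a b : ℝ) : Prop :=
  (∀ t ∈ Set.Ioc a b, ∃ L, Filter.Tendsto f (nhdsWithin t (Set.Ico a t)) (nhds L)) ∧
  (∀ t ∈ Set.Ico a b, ∃ L, Filter.Tendsto f (nhdsWithin t (Set.Ioc t b)) (nhds L))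

/-- `f` is regulated on `[0, ∞)`: one-sided limits exist at every point. -/
def RegulatedOnIci (f : ℝ → E) : Prop :=
  (∀ t : ℝ, 0 < t → ∃ L, Filter.Tendsto f (nhdsWithin t (Set.Ico 0 t)) (nhds L)) ∧
  (∀ t : ℝ, 0 ≤ t → ∃ L, Filter.Tendsto f (nhdsWithin t (Set.Ioi t)) (nhds L))

/-- A family `F` of functions is equiregulated on `[a, b]`. -/
def EquiregulatedOn (F : Set (ℝ → E)) (a b : ℝ) : Prop :=
  ∀ ε : ℝ, 0 < ε →
    (∀ τ ∈ Set.Ioc a b, ∃ δ > (0 : ℝ), ∀ y ∈ F, ∀ L,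
      Filter.Tendsto y (nhdsWithin τ (Set.Ico a τ)) (nhds L) →
      ∀ t ∈ Set.Ico a τ, τ - δ < t → ‖y t - L‖ < ε) ∧
    (∀ τ ∈ Set.Ico a b, ∃ δ > (0 : ℝ), ∀ y ∈ F, ∀ L,
      Filter.Tendsto y (nhdsWithin τ (Set.Ioc τ b)) (nhds L) →
      ∀ t ∈ Set.Ioc τ b, t < τ + δ → ‖y t - L‖ < ε)

/-- A D-function: continuous, nondecreasing on `[0, ∞)`, vanishing at `0`, positive on `(0, ∞)`. -/
def IsDFunction (φ : ℝ → ℝ) : Prop :=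
  ContinuousOn φ (Set.Ici 0) ∧ MonotoneOn φ (Set.Ici 0) ∧ φ 0 = 0 ∧
    ∀ s : ℝ, 0 < s → 0 < φ s

/-- `g` is left-continuous at every point of `(a, b]`. -/
def LeftContinuousOn (g : ℝ → ℝ) (a b : ℝ) : Prop :=
  ∀ t ∈ Set.Ioc a b, Filter.Tendsto g (nhdsWithin t (Set.Ico a t)) (nhds (g t))

/-- A bounded regulated function on `[0, ∞)` which is S-asymptotically `ω`-periodic. -/
def SAsympPeriodic (ω : ℝ) (x : ℝ → E) : Prop :=
  (∃ C : ℝ, ∀ t : ℝ, 0 ≤ t → ‖x t‖ ≤ C) ∧ RegulatedOnIci x ∧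
    Filter.Tendsto (fun t => x (t + ω) - x t) Filter.atTop (nhds 0)

end Defs

section KS

/-- A tagged partition of `[a, b]`. -/
structure TaggedPartition (a b : ℝ) where
  n : ℕ
  npos : 0 < n
  s : ℕ → ℝ
  τ : ℕ → ℝ
  s_first : s 0 = a
  s_last : s n = b
  s_mono : ∀ i < n, s i ≤ s (i + 1)
  tag_mem : ∀ i < n, τ i ∈ Set.Icc (s i) (s (i + 1))

/-- A tagged partition is `δ`-fine for a gauge `δ`. -/
def TaggedPartition.IsFine {a b : ℝ} (P : TaggedPartition a b) (δ : ℝ → ℝ) : Prop :=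
  ∀ i < P.n,
    Set.Icc (P.s i) (P.s (i + 1)) ⊆ Set.Ioo (P.τ i - δ (P.τ i)) (P.τ i + δ (P.τ i))

variable {E : Type*} [NormedAddCommGroup E] [NormedSpace ℝ E]

/-- The Kurzweil–Stieltjes Riemann sum of `f` w.r.t. `g` over a tagged partition. -/
def TaggedPartition.sum {a b : ℝ} (P : TaggedPartition a b) (f : ℝ → E) (g : ℝ → ℝ) : E :=
  ∑ i ∈ Finset.range P.n, (g (P.s (i + 1)) - g (P.s i)) • f (P.τ i)

/-- `I` is the Kurzweil–Stieltjes integral of `f` w.r.t. `g` over `[a, b]`. -/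
def HasKSIntegral (f : ℝ → E) (g : ℝ → ℝ) (a b : ℝ) (I : E) : Prop :=
  ∀ ε : ℝ, 0 < ε → ∃ δ : ℝ → ℝ, (∀ t, 0 < δ t) ∧
    ∀ P : TaggedPartition a b, P.IsFine δ → ‖P.sum f g - I‖ < ε

/-- `f` is Kurzweil–Stieltjes integrable w.r.t. `g` over `[a, b]`. -/
def KSIntegrable (f : ℝ → E) (g : ℝ → ℝ) (a b : ℝ) : Prop :=
  ∃ I, HasKSIntegral f g a b I

/-- A solution of the hybrid measure differential equation on `[t₀, t₀ + a]`
with data `(h, f, g, x₀)`. -/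
def IsHMDESolution (h f : ℝ → E → E) (g : ℝ → ℝ) (t₀ a : ℝ) (x₀ : E) (x : ℝ → E) : Prop :=
  RegulatedOn x t₀ (t₀ + a) ∧ x t₀ = x₀ ∧
  RegulatedOn (fun t => h t (x t)) t₀ (t₀ + a) ∧
  ∃ I : ℝ → E,
    (∀ t ∈ Set.Icc t₀ (t₀ + a), HasKSIntegral (fun s => f s (x s)) g t₀ t (I t)) ∧
    (∀ t ∈ Set.Icc t₀ (t₀ + a), x t = x₀ - h t₀ x₀ + h t (x t) + I t)

end KS

end HMDEPaper

namespace HMDEPaper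

open scoped ENNReal

section Intervals

/-- The interval function `X` is superadditive on `[α, β]`. -/
def SuperAdd (α β : ℝ) (X : ℝ → ℝ → ℝ≥0∞) : Prop :=
  ∀ u v w, α ≤ u → u ≤ v → v ≤ w → w ≤ β → X u v + X v w ≤ X u w

/-- `R τ u v` holds for every `τ ∈ [α, β]` and all small subintervals `[u, v] ∋ τ` of `[α, β]`. -/
def NearTags (α β : ℝ) (R : ℝ → ℝ → ℝ → Prop) : Prop :=
  ∀ τ ∈ Icc α β, ∃ r > 0, ∀ u v, α ≤ u → u ≤ τ → τ ≤ v → v ≤ β → τ - r < u → v < τ + r → R τ u v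

variable {α β : ℝ} {X Y : ℝ → ℝ → ℝ≥0∞}

theorem NearTags.and {R S : ℝ → ℝ → ℝ → Prop} (hR : NearTags α β R) (hS : NearTags α β S) :
    NearTags α β fun τ u v => R τ u v ∧ S τ u v := by
  intro τ hτ
  obtain ⟨r, hr, h⟩ := hR τ hτ
  obtain ⟨s, hs, k⟩ := hS τ hτ
  refine ⟨min r s, lt_min hr hs, fun u v h1 h2 h3 h4 h5 h6 => ⟨h u v h1 h2 h3 h4 ?_ ?_,
    k u v h1 h2 h3 h4 ?_ ?_⟩⟩ <;>
  linarith [min_le_left r s, min_le_right r s]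

theorem NearTags.imp {R S : ℝ → ℝ → ℝ → Prop} (hR : NearTags α β R)
    (h : ∀ τ u v, α ≤ u → u ≤ τ → τ ≤ v → v ≤ β → R τ u v → S τ u v) : NearTags α β S := by
  intro τ hτ
  obtain ⟨r, hr, k⟩ := hR τ hτ
  exact ⟨r, hr, fun u v h1 h2 h3 h4 h5 h6 => h τ u v h1 h2 h3 h4 (k u v h1 h2 h3 h4 h5 h6)⟩

theorem NearTags.mono {R : ℝ → ℝ → ℝ → Prop} (hR : NearTags α β R) {c d : ℝ} (hc : α ≤ c)
    (hd : d ≤ β) : NearTags c d R := by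
  intro τ hτ
  obtain ⟨r, hr, k⟩ := hR τ ⟨hc.trans hτ.1, hτ.2.trans hd⟩
  exact ⟨r, hr, fun u v h1 h2 h3 h4 => k u v (hc.trans h1) h2 h3 (h4.trans hd)⟩

/-- Cousin's lemma as an induction principle on intervals. -/
theorem NearTags.induction (hαβ : α ≤ β) {R : ℝ → ℝ → Prop}
    (hloc : NearTags α β fun _ => R)
    (hadd : ∀ u v w, α ≤ u → u ≤ v → v ≤ w → w ≤ β → R u v → R v w → R u w) : R α β := by
  set S := {t | t ∈ Icc α β ∧ R α t} with hS
  have hα : α ∈ S := by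
    obtain ⟨r, hr, h⟩ := hloc α ⟨le_rfl, hαβ⟩
    exact ⟨⟨le_rfl, hαβ⟩, h α α le_rfl le_rfl le_rfl hαβ (by linarith) (by linarith)⟩
  have hbdd : BddAbove S := ⟨β, fun t ht => ht.1.2⟩
  have h1 : α ≤ sSup S := le_csSup hbdd hα
  have h2 : sSup S ≤ β := csSup_le ⟨α, hα⟩ fun t ht => ht.1.2
  obtain ⟨r, hr, h⟩ := hloc (sSup S) ⟨h1, h2⟩
  obtain ⟨s, hs, hs'⟩ := exists_lt_of_lt_csSup ⟨α, hα⟩ (show sSup S - r < sSup S by linarith)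
  have hsle : s ≤ sSup S := le_csSup hbdd hs
  have key : ∀ v, sSup S ≤ v → v ≤ β → v < sSup S + r → R α v := fun v k1 k2 k3 =>
    hadd α s v le_rfl hs.1.1 (hsle.trans k1) k2 hs.2 (h s v hs.1.1 hsle k1 k2 hs' k3)
  rcases h2.eq_or_lt with h3 | h3
  · rw [h3] at key
    exact key β le_rfl le_rfl (by linarith)
  · have hv : sSup S < min β (sSup S + r / 2) := lt_min h3 (by linarith)
    have : min β (sSup S + r / 2) ∈ S :=
      ⟨⟨h1.trans hv.le, min_le_left _ _⟩, key _ hv.le (min_le_left _ _)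
        ((min_le_right _ _).trans_lt (by linarith))⟩
    exact absurd (le_csSup hbdd this) (not_le.2 hv)

theorem SuperAdd.mono_interval (hX : SuperAdd α β X) {u v : ℝ} (h1 : α ≤ u) (h2 : u ≤ v)
    (h3 : v ≤ β) : X u v ≤ X α β :=
  calc X u v ≤ X u v + X v β := le_self_add
    _ ≤ X u β := hX u v β h1 h2 h3 le_rfl
    _ ≤ X α u + X u β := le_add_self
    _ ≤ X α β := hX α u β le_rfl h1 (h2.trans h3) le_rfl

theorem SuperAdd.restrict (hX : SuperAdd α β X) {c d : ℝ} (hc : α ≤ c) (hd : d ≤ β) :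
    SuperAdd c d X :=
  fun u v w h1 h2 h3 h4 => hX u v w (hc.trans h1) h2 h3 (h4.trans hd)

theorem SuperAdd.add (hX : SuperAdd α β X) (hY : SuperAdd α β Y) :
    SuperAdd α β fun u v => X u v + Y u v := by
  intro u v w h1 h2 h3 h4
  calc X u v + Y u v + (X v w + Y v w) = (X u v + X v w) + (Y u v + Y v w) := by ring
    _ ≤ _ := add_le_add (hX u v w h1 h2 h3 h4) (hY u v w h1 h2 h3 h4)

theorem SuperAdd.sum {ι : Type*} (s : Finset ι) {X : ι → ℝ → ℝ → ℝ≥0∞}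
    (hX : ∀ i ∈ s, SuperAdd α β (X i)) : SuperAdd α β fun u v => ∑ i ∈ s, X i u v := by
  intro u v w h1 h2 h3 h4
  rw [← Finset.sum_add_distrib]
  exact Finset.sum_le_sum fun i hi => hX i hi u v w h1 h2 h3 h4

theorem SuperAdd.tsum {ι : Type*} {X : ι → ℝ → ℝ → ℝ≥0∞} (hX : ∀ i, SuperAdd α β (X i)) :
    SuperAdd α β fun u v => ∑' i, X i u v := by
  intro u v w h1 h2 h3 h4
  rw [← ENNReal.tsum_add]
  exact ENNReal.tsum_le_tsum fun i => hX i u v w h1 h2 h3 h4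

theorem SuperAdd.comp {φ : ℝ → ℝ} {c d : ℝ} (hX : SuperAdd α β X) (hφ : Monotone φ)
    (hc : α ≤ φ c) (hd : φ d ≤ β) : SuperAdd c d fun u v => X (φ u) (φ v) :=
  fun _ _ _ h1 h2 h3 h4 => hX _ _ _ (hc.trans (hφ h1)) (hφ h2) (hφ h3) ((hφ h4).trans hd)

theorem superAdd_ofReal_sub {G : ℝ → ℝ} (hG : MonotoneOn G (Icc α β)) :
    SuperAdd α β fun u v => ENNReal.ofReal (G v - G u) := by
  intro u v w h1 h2 h3 h4
  rw [← ENNReal.ofReal_add]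
  · simp
  · exact sub_nonneg.2 (hG ⟨h1, h2.trans (h3.trans h4)⟩ ⟨h1.trans h2, h3.trans h4⟩ h2)
  · exact sub_nonneg.2 (hG ⟨h1.trans h2, h3.trans h4⟩ ⟨h1.trans (h2.trans h3), h4⟩ h3)

/-- A subadditive interval function that is locally dominated by a superadditive one is dominated
by it. -/
theorem NearTags.le_of_superAdd (hαβ : α ≤ β) {Φ : ℝ → ℝ → ℝ≥0∞}
    (hloc : NearTags α β fun _ u v => Φ u v ≤ X u v) (hX : SuperAdd α β X)
    (hΦ : ∀ u v w, α ≤ u → u ≤ v → v ≤ w → w ≤ β → Φ u w ≤ Φ u v + Φ v w) : Φ α β ≤ X α β :=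
  NearTags.induction (R := fun u v => Φ u v ≤ X u v) hαβ hloc fun u v w h1 h2 h3 h4 h5 h6 =>
    (hΦ u v w h1 h2 h3 h4).trans ((add_le_add h5 h6).trans (hX u v w h1 h2 h3 h4))

end Intervals

namespace TaggedPartition

variable {E : Type*} [NormedAddCommGroup E] [NormedSpace ℝ E] {a b c : ℝ}

/-- The partition of `[a, b]` with the single tag `τ`. -/
def single {τ : ℝ} (h₁ : a ≤ τ) (h₂ : τ ≤ b) : TaggedPartition a b where
  n := 1
  npos := one_pos
  s i := if i = 0 then a else b
  τ _ := τ
  s_first := by simp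
  s_last := by simp
  s_mono i hi := by
    obtain rfl : i = 0 := by omega
    simpa using h₁.trans h₂
  tag_mem i hi := by
    obtain rfl : i = 0 := by omega
    simpa using And.intro h₁ h₂

theorem single_isFine {τ : ℝ} (h₁ : a ≤ τ) (h₂ : τ ≤ b) {δ : ℝ → ℝ} (h₃ : τ - δ τ < a)
    (h₄ : b < τ + δ τ) : (single h₁ h₂).IsFine δ := by
  intro i hi x hx
  have hi : i = 0 := Nat.lt_one_iff.1 hi
  subst hi
  simp only [single] at hx ⊢
  simp only [if_true, zero_add, one_ne_zero, if_false] at hx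
  exact ⟨h₃.trans_le hx.1, hx.2.trans_lt h₄⟩

theorem single_sum {τ : ℝ} (h₁ : a ≤ τ) (h₂ : τ ≤ b) (f : ℝ → E) (g : ℝ → ℝ) :
    (single h₁ h₂).sum f g = (g b - g a) • f τ := by
  simp [TaggedPartition.sum, single]

/-- Concatenation of partitions of adjacent intervals. -/
def append (P : TaggedPartition a b) (Q : TaggedPartition b c) : TaggedPartition a c where
  n := P.n + Q.n
  npos := by have := P.npos; omega
  s i := if i ≤ P.n then P.s i else Q.s (i - P.n)
  τ i := if i < P.n then P.τ i else Q.τ (i - P.n)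
  s_first := by simp [P.s_first]
  s_last := by
    have := Q.npos
    rw [if_neg (by omega), Nat.add_sub_cancel_left, Q.s_last]
  s_mono i hi := by
    rcases lt_trichotomy i P.n with h | h | h
    · rw [if_pos h.le, if_pos (by omega)]
      exact P.s_mono i h
    · subst h
      have := Q.s_mono 0 Q.npos
      rw [Q.s_first] at this
      rwa [if_pos le_rfl, if_neg (by omega), P.s_last, Nat.add_sub_cancel_left]
    · rw [if_neg (by omega), if_neg (by omega), Nat.sub_add_comm h.le]
      exact Q.s_mono _ (by omega)
  tag_mem i hi := by
    rcases lt_trichotomy i P.n with h | h | h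
    · rw [if_pos h, if_pos h.le, if_pos (by omega)]
      exact P.tag_mem i h
    · subst h
      have := Q.tag_mem 0 Q.npos
      rw [Q.s_first] at this
      rwa [if_neg (lt_irrefl _), if_pos le_rfl, if_neg (by omega), P.s_last,
        Nat.add_sub_cancel_left, Nat.sub_self]
    · rw [if_neg (by omega), if_neg (by omega), if_neg (by omega), Nat.sub_add_comm h.le]
      exact Q.tag_mem _ (by omega)

variable (P : TaggedPartition a b) (Q : TaggedPartition b c)

theorem append_s_left {i : ℕ} (hi : i ≤ P.n) : (P.append Q).s i = P.s i := if_pos hi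

theorem append_s_right (i : ℕ) : (P.append Q).s (P.n + i) = Q.s i := by
  rcases Nat.eq_zero_or_pos i with rfl | h
  · simp [append, P.s_last, Q.s_first]
  · simp only [append]
    rw [if_neg (by omega), Nat.add_sub_cancel_left]

theorem append_τ_left {i : ℕ} (hi : i < P.n) : (P.append Q).τ i = P.τ i := if_pos hi

theorem append_τ_right (i : ℕ) : (P.append Q).τ (P.n + i) = Q.τ i := by
  simp [append]

theorem append_sum (f : ℝ → E) (g : ℝ → ℝ) : (P.append Q).sum f g = P.sum f g + Q.sum f g := by
  unfold TaggedPartition.sum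
  change ∑ i ∈ Finset.range (P.n + Q.n), _ = _
  rw [Finset.sum_range_add]
  congr 1
  · refine Finset.sum_congr rfl fun i hi => ?_
    rw [Finset.mem_range] at hi
    rw [append_s_left P Q (by omega), append_s_left P Q (by omega), append_τ_left P Q hi]
  · refine Finset.sum_congr rfl fun i _ => ?_
    rw [append_s_right, add_assoc, append_s_right, append_τ_right]

variable {P Q}

theorem IsFine.append {δ : ℝ → ℝ} (hP : P.IsFine δ) (hQ : Q.IsFine δ) :
    (P.append Q).IsFine δ := by
  intro i hi
  rcases lt_or_ge i P.n with h | h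
  · rw [append_s_left P Q (by omega), append_s_left P Q (by omega), append_τ_left P Q h]
    exact hP i h
  · obtain ⟨j, rfl⟩ := Nat.exists_eq_add_of_le h
    rw [append_s_right, add_assoc, append_s_right, append_τ_right]
    exact hQ j (by change _ < P.n + Q.n at hi; omega)

theorem exists_isFine (hab : a ≤ b) {δ : ℝ → ℝ} (hδ : ∀ t, 0 < δ t) :
    ∃ P : TaggedPartition a b, P.IsFine δ := by
  refine NearTags.induction (R := fun u v => ∃ P : TaggedPartition u v, P.IsFine δ) hab ?_ ?_
  · intro τ _
    exact ⟨δ τ, hδ τ, fun u v _ h2 h3 _ h5 h6 => ⟨single h2 h3, single_isFine h2 h3 h5 h6⟩⟩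
  · rintro u v w - - - - ⟨P, hP⟩ ⟨Q, hQ⟩
    exact ⟨P.append Q, hP.append hQ⟩

theorem IsFine.mono {δ δ' : ℝ → ℝ} (hP : P.IsFine δ) (h : ∀ t, δ t ≤ δ' t) : P.IsFine δ' :=
  fun i hi => (hP i hi).trans (Ioo_subset_Ioo (by linarith [h (P.τ i)]) (by linarith [h (P.τ i)]))

theorem s_mem (P : TaggedPartition a b) {i : ℕ} (hi : i ≤ P.n) : P.s i ∈ Icc a b := by
  constructor
  · induction i with
    | zero => exact P.s_first.ge
    | succ i ih => exact (ih (by omega)).trans (P.s_mono i (by omega))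
  · refine Nat.decreasingInduction' (P := fun i => P.s i ≤ b) ?_ hi P.s_last.le
    intro k hk _ h
    exact (P.s_mono k hk).trans h

/-- The filter of tagged partitions of `[a, b]` along the gauges. -/
def fineFilter (a b : ℝ) : Filter (TaggedPartition a b) :=
  ⨅ δ ∈ {δ : ℝ → ℝ | ∀ t, 0 < δ t}, 𝓟 {P | P.IsFine δ}

theorem hasBasis_fineFilter (a b : ℝ) :
    (fineFilter a b).HasBasis (fun δ : ℝ → ℝ => ∀ t, 0 < δ t) fun δ => {P | P.IsFine δ} := by
  refine hasBasis_biInf_principal ?_ ⟨fun _ => 1, fun _ => one_pos⟩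
  intro δ hδ δ' hδ'
  exact ⟨fun t => min (δ t) (δ' t), fun t => lt_min (hδ t) (hδ' t),
    fun P (hP : P.IsFine _) => hP.mono fun t => min_le_left _ _,
    fun P (hP : P.IsFine _) => hP.mono fun t => min_le_right _ _⟩

theorem fineFilter_neBot (hab : a ≤ b) : (fineFilter a b).NeBot :=
  (hasBasis_fineFilter a b).neBot_iff.2 fun hδ => exists_isFine hab hδ

end TaggedPartition

section Integral

open TaggedPartition

variable {E : Type*} [NormedAddCommGroup E] [NormedSpace ℝ E] {f : ℝ → E} {g : ℝ → ℝ}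
  {a b c : ℝ} {I J K : E}

theorem hasKSIntegral_iff_tendsto :
    HasKSIntegral f g a b I ↔ Tendsto (fun P => P.sum f g) (fineFilter a b) (𝓝 I) := by
  rw [(hasBasis_fineFilter a b).tendsto_iff Metric.nhds_basis_ball]
  simp [HasKSIntegral, dist_eq_norm]

theorem HasKSIntegral.unique (hab : a ≤ b) (hI : HasKSIntegral f g a b I)
    (hJ : HasKSIntegral f g a b J) : I = J :=
  have := fineFilter_neBot hab
  tendsto_nhds_unique (hasKSIntegral_iff_tendsto.1 hI) (hasKSIntegral_iff_tendsto.1 hJ)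

theorem HasKSIntegral.add_interval (hab : a ≤ b) (hbc : b ≤ c) (hI : HasKSIntegral f g a b I)
    (hJ : HasKSIntegral f g b c J) (hK : HasKSIntegral f g a c K) : I + J = K := by
  refine eq_of_forall_dist_le fun ε hε => ?_
  obtain ⟨δ₁, p₁, h₁⟩ := hI (ε / 3) (by positivity)
  obtain ⟨δ₂, p₂, h₂⟩ := hJ (ε / 3) (by positivity)
  obtain ⟨δ₃, p₃, h₃⟩ := hK (ε / 3) (by positivity)
  have hδ : ∀ t, 0 < min (δ₁ t) (min (δ₂ t) (δ₃ t)) :=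
    fun t => lt_min (p₁ t) (lt_min (p₂ t) (p₃ t))
  obtain ⟨P, hP⟩ := exists_isFine hab hδ
  obtain ⟨Q, hQ⟩ := exists_isFine hbc hδ
  have k₁ := h₁ P (hP.mono fun t => min_le_left _ _)
  have k₂ := h₂ Q (hQ.mono fun t => (min_le_right _ _).trans (min_le_left _ _))
  have k₃ := h₃ (P.append Q)
    ((hP.append hQ).mono fun t => (min_le_right _ _).trans (min_le_right _ _))
  rw [append_sum] at k₃
  rw [dist_eq_norm]
  have : I + J - K = (P.sum f g + Q.sum f g - K) - (P.sum f g - I) - (Q.sum f g - J) := by abel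
  rw [this]
  refine (norm_sub_le _ _).trans ((add_le_add (norm_sub_le _ _) le_rfl).trans ?_)
  linarith

theorem HasKSIntegral.exists_gauge_cauchy (hI : HasKSIntegral f g a b I) {ε : ℝ} (hε : 0 < ε) :
    ∃ δ : ℝ → ℝ, (∀ t, 0 < δ t) ∧ ∀ u v, a ≤ u → u ≤ v → v ≤ b →
      ∀ P Q : TaggedPartition u v, P.IsFine δ → Q.IsFine δ → ‖P.sum f g - Q.sum f g‖ < ε := by
  obtain ⟨δ, p, h⟩ := hI (ε / 2) (by positivity)
  refine ⟨δ, p, fun u v h1 h2 h3 P Q hP hQ => ?_⟩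
  obtain ⟨A, hA⟩ := exists_isFine h1 p
  obtain ⟨B, hB⟩ := exists_isFine h3 p
  have k₁ := h _ ((hA.append hP).append hB)
  have k₂ := h _ ((hA.append hQ).append hB)
  simp only [append_sum] at k₁ k₂
  have : P.sum f g - Q.sum f g = (A.sum f g + P.sum f g + B.sum f g - I)
    - (A.sum f g + Q.sum f g + B.sum f g - I) := by abel
  rw [this]
  exact (norm_sub_le _ _).trans_lt (by linarith)

theorem KSIntegrable.mono [CompleteSpace E] (hf : KSIntegrable f g a b) {u v : ℝ} (h1 : a ≤ u)
    (h2 : u ≤ v) (h3 : v ≤ b) : KSIntegrable f g u v := by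
  obtain ⟨I, hI⟩ := hf
  have := fineFilter_neBot h2
  have hc : Cauchy (map (fun P => P.sum f g) (fineFilter u v)) := by
    refine cauchy_iff.2 ⟨inferInstance, fun s hs => ?_⟩
    obtain ⟨ε, hε, hs⟩ := Metric.mem_uniformity_dist.1 hs
    obtain ⟨δ, p, h⟩ := hI.exists_gauge_cauchy hε
    refine ⟨_, image_mem_map ((hasBasis_fineFilter u v).mem_of_mem p), ?_⟩
    rintro ⟨_, _⟩ ⟨⟨P, hP, rfl⟩, ⟨Q, hQ, rfl⟩⟩
    exact hs ((dist_eq_norm _ _).trans_lt (h u v h1 h2 h3 P Q hP hQ))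
  obtain ⟨J, hJ⟩ := cauchy_map_iff_exists_tendsto.1 hc
  exact ⟨J, hasKSIntegral_iff_tendsto.2 hJ⟩

/-- The primitive normalised at `a`, available on all of `[a, b]`. -/
theorem KSIntegrable.exists_primitive [CompleteSpace E] (hf : KSIntegrable f g a b) :
    ∃ H : ℝ → E, ∀ u v, a ≤ u → u ≤ v → v ≤ b → HasKSIntegral f g u v (H v - H u) := by
  have : ∀ t, ∃ I, a ≤ t → t ≤ b → HasKSIntegral f g a t I := by
    intro t
    by_cases h : a ≤ t ∧ t ≤ b
    · obtain ⟨I, hI⟩ := hf.mono le_rfl h.1 h.2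
      exact ⟨I, fun _ _ => hI⟩
    · exact ⟨0, fun h1 h2 => absurd ⟨h1, h2⟩ h⟩
  choose H hH using this
  refine ⟨H, fun u v h1 h2 h3 => ?_⟩
  obtain ⟨I, hI⟩ := hf.mono h1 h2 h3
  have := (hH u h1 (h2.trans h3)).add_interval h1 h2 hI (hH v (h1.trans h2) h3)
  rw [← this, add_sub_cancel_left]
  exact hI

end Integral

section VariationalPrimitive

open TaggedPartition

variable {E : Type*} [NormedAddCommGroup E] [NormedSpace ℝ E] {f f' : ℝ → E} {g : ℝ → ℝ}
  {H : ℝ → E} {a b c : ℝ}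

/-- `H` is a primitive of `f` with respect to `g` on `[a, b]`, in Henstock's variational sense. -/
def IsVarPrimitive (f : ℝ → E) (g : ℝ → ℝ) (H : ℝ → E) (a b : ℝ) : Prop :=
  ∀ ε : ℝ≥0∞, 0 < ε → ∃ X, SuperAdd a b X ∧ X a b ≤ ε ∧
    NearTags a b fun τ u v => ‖H v - H u - (g v - g u) • f τ‖ₑ ≤ X u v

theorem exists_pos_ofReal_le {ε : ℝ≥0∞} (hε : 0 < ε) : ∃ r : ℝ, 0 < r ∧ ENNReal.ofReal r ≤ ε := by
  obtain ⟨r, -, h1, h2⟩ := ENNReal.lt_iff_exists_real_btwn.1 hε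
  exact ⟨r, ENNReal.ofReal_pos.1 h1, h2.le⟩

/-- The Saks–Henstock lemma for real-valued functions. -/
theorem isVarPrimitive_of_hasKSIntegral_real {f H : ℝ → ℝ} (hab : a ≤ b)
    (hH : ∀ u v, a ≤ u → u ≤ v → v ≤ b → HasKSIntegral f g u v (H v - H u)) :
    IsVarPrimitive f g H a b := by
  intro ε hε
  obtain ⟨r, hr, hrε⟩ := exists_pos_ofReal_le hε
  obtain ⟨δ, p, h⟩ := (hH a b le_rfl hab le_rfl).exists_gauge_cauchy hr
  let X : ℝ → ℝ → ℝ≥0∞ := fun u v =>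
    ⨆ q : {P : TaggedPartition u v // P.IsFine δ} × {P : TaggedPartition u v // P.IsFine δ},
      ‖q.1.1.sum f g - q.2.1.sum f g‖ₑ
  have le_X : ∀ {u v : ℝ} (P Q : TaggedPartition u v), P.IsFine δ → Q.IsFine δ →
      ‖P.sum f g - Q.sum f g‖ₑ ≤ X u v := fun P Q hP hQ =>
    le_iSup (fun q : {P : TaggedPartition _ _ // P.IsFine δ} ×
      {P : TaggedPartition _ _ // P.IsFine δ} => ‖q.1.1.sum f g - q.2.1.sum f g‖ₑ)
      ⟨⟨P, hP⟩, ⟨Q, hQ⟩⟩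
  have swap : ∀ {u v : ℝ} (q : {P : TaggedPartition u v // P.IsFine δ} ×
      {P : TaggedPartition u v // P.IsFine δ}), ∃ P Q : TaggedPartition u v, P.IsFine δ ∧
      Q.IsFine δ ∧ 0 ≤ P.sum f g - Q.sum f g ∧
      ‖q.1.1.sum f g - q.2.1.sum f g‖ₑ = ENNReal.ofReal (P.sum f g - Q.sum f g) := by
    rintro u v ⟨⟨P, hP⟩, ⟨Q, hQ⟩⟩
    rcases le_total 0 (P.sum f g - Q.sum f g) with h0 | h0
    · exact ⟨P, Q, hP, hQ, h0, Real.enorm_of_nonneg h0⟩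
    · refine ⟨Q, P, hQ, hP, by linarith, ?_⟩
      rw [← Real.enorm_of_nonneg (by linarith), ← enorm_neg, neg_sub]
  refine ⟨X, ?_, ?_, ?_⟩
  · intro u v w h1 h2 h3 h4
    obtain ⟨P₀, hP₀⟩ := exists_isFine h2 p
    obtain ⟨Q₀, hQ₀⟩ := exists_isFine h3 p
    have : Nonempty {P : TaggedPartition u v // P.IsFine δ} := ⟨⟨P₀, hP₀⟩⟩
    have : Nonempty {P : TaggedPartition v w // P.IsFine δ} := ⟨⟨Q₀, hQ₀⟩⟩
    refine ENNReal.iSup_add_iSup_le fun q q' => ?_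
    obtain ⟨P, Q, hP, hQ, h0, he⟩ := swap q
    obtain ⟨P', Q', hP', hQ', h0', he'⟩ := swap q'
    rw [he, he', ← ENNReal.ofReal_add h0 h0']
    have := le_X (P.append P') (Q.append Q') (hP.append hP') (hQ.append hQ')
    refine le_trans ?_ this
    rw [append_sum, append_sum, Real.enorm_of_nonneg (by linarith)]
    exact ENNReal.ofReal_le_ofReal (by linarith)
  · refine iSup_le fun q => le_trans ?_ hrε
    rw [← ofReal_norm]
    exact ENNReal.ofReal_le_ofReal (h a b le_rfl hab le_rfl _ _ q.1.2 q.2.2).le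
  · intro τ _
    refine ⟨δ τ, p τ, fun u v h1 h2 h3 h4 h5 h6 => ?_⟩
    have := fineFilter_neBot (h2.trans h3)
    have ht := hasKSIntegral_iff_tendsto.1 (hH u v h1 (h2.trans h3) h4)
    refine le_of_tendsto ((ht.sub_const ((g v - g u) • f τ)).enorm) ?_
    filter_upwards [(hasBasis_fineFilter u v).mem_of_mem p] with Q hQ
    rw [← single_sum h2 h3 f g]
    exact le_X _ _ hQ (single_isFine h2 h3 h5 h6)

theorem IsVarPrimitive.of_components {ι F : Type*} [Fintype ι] [NormedAddCommGroup F]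
    [NormedSpace ℝ F] (L : ι → E →L[ℝ] F) (hL : ∀ e, ‖e‖ₑ ≤ ∑ i, ‖L i e‖ₑ)
    (hH : ∀ i, IsVarPrimitive (fun t => L i (f t)) g (fun t => L i (H t)) a b) :
    IsVarPrimitive f g H a b := by
  intro ε hε
  obtain ⟨η, hη, hηε⟩ := ENNReal.exists_pos_sum_of_countable' hε.ne' ι
  choose X hX hXη hXH using fun i => hH i (η i) (hη i)
  refine ⟨fun u v => ∑ i, X i u v, SuperAdd.sum _ fun i _ => hX i, ?_, ?_⟩
  · rw [tsum_fintype] at hηε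
    exact (Finset.sum_le_sum fun i _ => hXη i).trans hηε.le
  · intro τ hτ
    choose r hr hrX using fun i => hXH i τ hτ
    obtain ⟨ρ, hρ, hρr⟩ : ∃ ρ > 0, ∀ i, ρ ≤ r i := by
      rcases isEmpty_or_nonempty ι with h | h
      · exact ⟨1, one_pos, fun i => h.elim i⟩
      · exact ⟨Finset.univ.inf' Finset.univ_nonempty r, by simpa using hr,
          fun i => Finset.inf'_le _ (Finset.mem_univ i)⟩
    refine ⟨ρ, hρ, fun u v h1 h2 h3 h4 h5 h6 => (hL _).trans (Finset.sum_le_sum fun i _ => ?_)⟩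
    have := hrX i u v h1 h2 h3 h4 (by linarith [hρr i]) (by linarith [hρr i])
    simpa using this

theorem HasKSIntegral.map {F : Type*} [NormedAddCommGroup F] [NormedSpace ℝ F] (L : E →L[ℝ] F)
    {I : E} (hI : HasKSIntegral f g a b I) : HasKSIntegral (fun t => L (f t)) g a b (L I) := by
  rw [hasKSIntegral_iff_tendsto] at hI ⊢
  refine ((L.continuous.tendsto I).comp hI).congr fun P => ?_
  simp [TaggedPartition.sum]

theorem isVarPrimitive_of_hasKSIntegral {n : ℕ} {f H : ℝ → En n} (hab : a ≤ b)
    (hH : ∀ u v, a ≤ u → u ≤ v → v ≤ b → HasKSIntegral f g u v (H v - H u)) :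
    IsVarPrimitive f g H a b := by
  refine IsVarPrimitive.of_components (fun i : Fin n => EuclideanSpace.proj i) (fun e => ?_)
    fun i => isVarPrimitive_of_hasKSIntegral_real hab fun u v h1 h2 h3 => ?_
  · have : e = ∑ i, EuclideanSpace.single i (e i) := by
      ext j
      simp [Finset.sum_apply, Pi.single_apply]
    calc ‖e‖ₑ = ‖∑ i, EuclideanSpace.single i (e i)‖ₑ := by rw [← this]
      _ ≤ ∑ i, ‖EuclideanSpace.single i (e i)‖ₑ := enorm_sum_le _ _
      _ ≤ _ := Finset.sum_le_sum fun i _ => by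
        rw [← ofReal_norm, ← ofReal_norm]
        simp
  · simpa using (hH u v h1 h2 h3).map (EuclideanSpace.proj i)

theorem SuperAdd.sum_range_le {X : ℝ → ℝ → ℝ≥0∞} (hX : SuperAdd a b X) {s : ℕ → ℝ} {n : ℕ}
    (hs : ∀ i ≤ n, s i ≤ s (i + 1)) (h0 : a ≤ s 0) (hn : s (n + 1) ≤ b) :
    ∑ i ∈ Finset.range (n + 1), X (s i) (s (i + 1)) ≤ X (s 0) (s (n + 1)) := by
  induction n with
  | zero => simp
  | succ n ih =>
    have h : s 0 ≤ s (n + 1) := by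
      have : ∀ k ≤ n + 1, s 0 ≤ s k := by
        intro k hk
        induction k with
        | zero => rfl
        | succ k ihk => exact (ihk (by omega)).trans (hs k (by omega))
      exact this _ le_rfl
    rw [Finset.sum_range_succ]
    refine (add_le_add (ih (fun i hi => hs i (by omega)) ((hs _ le_rfl).trans hn)) le_rfl).trans ?_
    exact hX _ _ _ h0 h (hs _ le_rfl) hn

theorem IsVarPrimitive.hasKSIntegral (hH : IsVarPrimitive f g H a b) {u v : ℝ} (h1 : a ≤ u)
    (h2 : u ≤ v) (h3 : v ≤ b) : HasKSIntegral f g u v (H v - H u) := by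
  intro ε hε
  obtain ⟨X, hX, hXε, hloc⟩ := hH (ENNReal.ofReal (ε / 2)) (by simpa using hε)
  have : ∀ τ, ∃ r > 0, τ ∈ Icc a b → ∀ u v, a ≤ u → u ≤ τ → τ ≤ v → v ≤ b → τ - r < u →
      v < τ + r → ‖H v - H u - (g v - g u) • f τ‖ₑ ≤ X u v := by
    intro τ
    by_cases hτ : τ ∈ Icc a b
    · obtain ⟨r, hr, h⟩ := hloc τ hτ
      exact ⟨r, hr, fun _ => h⟩
    · exact ⟨1, one_pos, fun h => absurd h hτ⟩
  choose δ hδ h using this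
  refine ⟨δ, hδ, fun P hP => ?_⟩
  have hmem : ∀ i ≤ P.n, P.s i ∈ Icc a b := fun i hi => Icc_subset_Icc h1 h3 (P.s_mem hi)
  have hsum : H v - H u - P.sum f g = ∑ i ∈ Finset.range P.n,
      (H (P.s (i + 1)) - H (P.s i) - (g (P.s (i + 1)) - g (P.s i)) • f (P.τ i)) := by
    rw [Finset.sum_sub_distrib, Finset.sum_range_sub (fun i => H (P.s i)), P.s_last, P.s_first]
    rfl
  have hle : ‖H v - H u - P.sum f g‖ₑ ≤ X u v := by
    rw [hsum]
    refine (enorm_sum_le _ _).trans (le_trans (Finset.sum_le_sum fun i hi => ?_)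
      (b := ∑ i ∈ Finset.range P.n, X (P.s i) (P.s (i + 1))) ?_)
    · rw [Finset.mem_range] at hi
      have hi' := P.tag_mem i hi
      have hfine := hP i hi
      refine h _ ⟨(hmem i hi.le).1.trans hi'.1, hi'.2.trans (hmem (i + 1) hi).2⟩ _ _
        (hmem i hi.le).1 hi'.1 hi'.2 (hmem (i + 1) hi).2
        (hfine ⟨le_rfl, P.s_mono i hi⟩).1 (hfine ⟨P.s_mono i hi, le_rfl⟩).2
    · obtain ⟨m, hm⟩ := Nat.exists_eq_succ_of_ne_zero P.npos.ne'
      have := hX.sum_range_le (s := P.s) (n := m) (fun i hi => P.s_mono i (by omega))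
        (hmem 0 (by omega)).1 (hmem (m + 1) (by omega)).2
      rw [← Nat.succ_eq_add_one, ← hm, P.s_first, P.s_last] at this
      exact this
  rw [norm_sub_rev]
  have := hle.trans ((hX.mono_interval h1 h2 h3).trans hXε)
  rw [← ofReal_norm, ENNReal.ofReal_le_ofReal_iff (by positivity)] at this
  linarith

theorem IsVarPrimitive.restrict (hH : IsVarPrimitive f g H a b) {u v : ℝ} (h1 : a ≤ u)
    (h2 : u ≤ v) (h3 : v ≤ b) : IsVarPrimitive f g H u v := by
  intro ε hε
  obtain ⟨X, hX, hXε, hloc⟩ := hH ε hε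
  exact ⟨X, hX.restrict h1 h3, (hX.mono_interval h1 h2 h3).trans hXε, hloc.mono h1 h3⟩

theorem IsVarPrimitive.sub {H' : ℝ → E} (hH : IsVarPrimitive f g H a b)
    (hH' : IsVarPrimitive f' g H' a b) :
    IsVarPrimitive (fun t => f t - f' t) g (fun t => H t - H' t) a b := by
  intro ε hε
  obtain ⟨X, hX, hXε, hloc⟩ := hH (ε / 2) (ENNReal.half_pos hε.ne')
  obtain ⟨X', hX', hXε', hloc'⟩ := hH' (ε / 2) (ENNReal.half_pos hε.ne')
  refine ⟨_, hX.add hX', (add_le_add hXε hXε').trans (ENNReal.add_halves ε).le,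
    (hloc.and hloc').imp fun τ u v _ _ _ _ h => ?_⟩
  have : H v - H' v - (H u - H' u) - (g v - g u) • (f τ - f' τ) =
      (H v - H u - (g v - g u) • f τ) - (H' v - H' u - (g v - g u) • f' τ) := by
    rw [smul_sub]
    abel
  rw [this]
  exact (enorm_sub_le).trans (add_le_add h.1 h.2)

theorem IsVarPrimitive.concat {H' : ℝ → E} (hab : a ≤ b) (hbc : b ≤ c)
    (hH : IsVarPrimitive f g H a b) (hH' : IsVarPrimitive f g H' b c) :
    IsVarPrimitive f g (fun t => H (min t b) + H' (max t b)) a c := by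
  intro ε hε
  obtain ⟨X, hX, hXε, hloc⟩ := hH (ε / 2) (ENNReal.half_pos hε.ne')
  obtain ⟨X', hX', hXε', hloc'⟩ := hH' (ε / 2) (ENNReal.half_pos hε.ne')
  refine ⟨_, (hX.comp (φ := fun t => min t b) (c := a) (d := c)
    (fun _ _ h => min_le_min_right b h) (le_min le_rfl hab) (min_le_right _ _)).add
    (hX'.comp (φ := fun t => max t b) (c := a) (d := c)
    (fun _ _ h => max_le_max_right b h) (le_max_right _ _) (max_le le_rfl hbc)),
    ?_, ?_⟩
  · simp only [min_eq_left hab, min_eq_right hbc, max_eq_right hab, max_eq_left hbc]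
    exact (add_le_add hXε hXε').trans (ENNReal.add_halves ε).le
  · intro τ hτ
    rcases lt_trichotomy τ b with h | h | h
    · obtain ⟨r, hr, k⟩ := hloc τ ⟨hτ.1, h.le⟩
      refine ⟨min r (b - τ), lt_min hr (sub_pos.2 h), fun u v h1 h2 h3 h4 h5 h6 => ?_⟩
      have hv : v < b := by linarith [min_le_right r (b - τ)]
      have hu : u < b := by linarith
      simp only [min_eq_left hv.le, min_eq_left hu.le, max_eq_right hv.le, max_eq_right hu.le]
      refine le_trans (le_trans (le_of_eq ?_) (k u v h1 h2 h3 hv.le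
        (by linarith [min_le_left r (b - τ)]) (by linarith [min_le_left r (b - τ)]))) le_self_add
      congr 2
      abel
    · subst h
      obtain ⟨r, hr, k⟩ := hloc τ ⟨hτ.1, le_rfl⟩
      obtain ⟨r', hr', k'⟩ := hloc' τ ⟨le_rfl, hτ.2⟩
      refine ⟨min r r', lt_min hr hr', fun u v h1 h2 h3 h4 h5 h6 => ?_⟩
      simp only [min_eq_left h2, min_eq_right h3, max_eq_right h2, max_eq_left h3]
      have e : H τ + H' v - (H u + H' τ) - (g v - g u) • f τ =
          (H τ - H u - (g τ - g u) • f τ) + (H' v - H' τ - (g v - g τ) • f τ) := by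
        have : g v - g u = (g τ - g u) + (g v - g τ) := by ring
        rw [this, add_smul]
        abel
      rw [e]
      exact (enorm_add_le _ _).trans (add_le_add
        (k u τ h1 h2 le_rfl le_rfl (by linarith [min_le_left r r']) (by linarith))
        (k' τ v le_rfl le_rfl h3 h4 (by linarith) (by linarith [min_le_right r r'])))
    · obtain ⟨r, hr, k⟩ := hloc' τ ⟨h.le, hτ.2⟩
      refine ⟨min r (τ - b), lt_min hr (sub_pos.2 h), fun u v h1 h2 h3 h4 h5 h6 => ?_⟩
      have hu : b < u := by linarith [min_le_right r (τ - b)]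
      have hv : b < v := by linarith
      simp only [min_eq_right hv.le, min_eq_right hu.le, max_eq_left hv.le, max_eq_left hu.le]
      refine le_trans (le_trans (le_of_eq ?_) (k u v hu.le h2 h3 h4
        (by linarith [min_le_left r (τ - b)]) (by linarith [min_le_left r (τ - b)]))) le_add_self
      congr 2
      abel

/-- Changing the integrand at the right endpoint does not affect the primitive if the integrator
is left-continuous there. -/
theorem IsVarPrimitive.congr_Ico (hH : IsVarPrimitive f g H a b)
    (hf : ∀ t ∈ Ico a b, f' t = f t) (hg : a < b → Tendsto g (𝓝[<] b) (𝓝 (g b))) :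
    IsVarPrimitive f' g H a b := by
  intro ε hε
  obtain ⟨X, hX, hXε, hloc⟩ := hH (ε / 2) (ENNReal.half_pos hε.ne')
  let Y : ℝ → ℝ → ℝ≥0∞ := fun u v => if u < b ∧ b ≤ v then ε / 2 else 0
  have hY : SuperAdd a b Y := by
    intro u v w h1 h2 h3 h4
    by_cases huv : u < b ∧ b ≤ v
    · have : ¬ (v < b ∧ b ≤ w) := fun h => absurd huv.2 (not_le.2 h.1)
      simp only [Y, if_neg this, if_pos huv, add_zero, if_pos (And.intro huv.1 (huv.2.trans h3))]
      exact le_rfl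
    · by_cases hvw : v < b ∧ b ≤ w
      · simp only [Y, if_neg huv, if_pos hvw, zero_add,
          if_pos (And.intro (h2.trans_lt hvw.1) hvw.2)]
        exact le_rfl
      · simp [Y, if_neg huv, if_neg hvw]
  refine ⟨_, hX.add hY, ?_, ?_⟩
  · refine (add_le_add hXε (?_ : _ ≤ ε / 2)).trans (ENNReal.add_halves ε).le
    simp only [Y]
    split_ifs <;> simp
  · intro τ hτ
    obtain ⟨r, hr, k⟩ := hloc τ hτ
    rcases hτ.2.eq_or_lt with rfl | h
    · rcases hτ.1.eq_or_lt with rfl | haτ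
      · refine ⟨r, hr, fun u v h1 h2 h3 h4 _ _ => ?_⟩
        obtain rfl : u = a := le_antisymm h2 h1
        obtain rfl : v = u := le_antisymm h4 h3
        simp
      · have ht : Tendsto (fun u => ‖(g τ - g u) • (f τ - f' τ)‖ₑ) (𝓝[<] τ) (𝓝 0) := by
          have := ((tendsto_const_nhds (x := g τ)).sub (hg haτ)).smul_const (f τ - f' τ)
          simpa using this.enorm
        have hev := ht.eventually (ge_mem_nhds (ENNReal.half_pos hε.ne'))
        obtain ⟨l, hl, hsub⟩ := (mem_nhdsLT_iff_exists_Ioo_subset).1 hev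
        refine ⟨min r (τ - l), lt_min hr (sub_pos.2 hl), fun u v h1 h2 h3 h4 h5 h6 => ?_⟩
        obtain rfl : v = τ := le_antisymm h4 h3
        rcases h2.eq_or_lt with rfl | hu
        · simp
        · have e : H v - H u - (g v - g u) • f' v =
              (H v - H u - (g v - g u) • f v) + (g v - g u) • (f v - f' v) := by
            rw [smul_sub]
            abel
          rw [e]
          refine (enorm_add_le _ _).trans (add_le_add (k u v h1 h2 le_rfl le_rfl
            (by linarith [min_le_left r (v - l)]) (by linarith)) ?_)
          simp only [Y, if_pos (And.intro hu le_rfl)]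
          exact hsub ⟨by linarith [min_le_right r (v - l)], hu⟩
    · refine ⟨r, hr, fun u v h1 h2 h3 h4 h5 h6 => ?_⟩
      change _ ≤ X u v + Y u v
      rw [hf τ ⟨hτ.1, h⟩]
      exact (k u v h1 h2 h3 h4 h5 h6).trans le_self_add

end VariationalPrimitive

section Variation

variable {E : Type*} [NormedAddCommGroup E] {H : ℝ → E} {a b : ℝ}

theorem NearTags.split {R : ℝ → ℝ → ℝ → Prop} (hR : NearTags a b R) :
    NearTags a b fun τ u v => R τ u τ ∧ R τ τ v := by
  intro τ hτ
  obtain ⟨r, hr, h⟩ := hR τ hτ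
  exact ⟨r, hr, fun u v h1 h2 h3 h4 h5 h6 =>
    ⟨h u τ h1 h2 le_rfl hτ.2 h5 (by linarith), h τ v hτ.1 le_rfl h3 h4 (by linarith) h6⟩⟩

theorem eVariationOn_Icc_add (H : ℝ → E) {u v w : ℝ} (h1 : u ≤ v) (h2 : v ≤ w) :
    eVariationOn H (Icc u v) + eVariationOn H (Icc v w) = eVariationOn H (Icc u w) := by
  simpa using eVariationOn.Icc_add_Icc H (s := univ) h1 h2 (mem_univ v)

theorem SuperAdd.tsub {X Y : ℝ → ℝ → ℝ≥0∞} (hX : SuperAdd a b X)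
    (hY : ∀ u v w, a ≤ u → u ≤ v → v ≤ w → w ≤ b → Y u w ≤ Y u v + Y v w)
    (hle : ∀ u v, a ≤ u → u ≤ v → v ≤ b → Y u v ≤ X u v)
    (hfin : ∀ u v, a ≤ u → u ≤ v → v ≤ b → Y u v ≠ ⊤) :
    SuperAdd a b fun u v => X u v - Y u v := by
  intro u v w h1 h2 h3 h4
  refine ENNReal.le_sub_of_add_le_right (hfin u w h1 (h2.trans h3) h4) ?_
  calc _ ≤ X u v - Y u v + (X v w - Y v w) + (Y u v + Y v w) :=
        add_le_add le_rfl (hY u v w h1 h2 h3 h4)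
    _ = (X u v - Y u v + Y u v) + (X v w - Y v w + Y v w) := by ring
    _ = X u v + X v w := by
      rw [tsub_add_cancel_of_le (hle u v h1 h2 (h3.trans h4)),
        tsub_add_cancel_of_le (hle v w (h1.trans h2) h3 h4)]
    _ ≤ X u w := hX u v w h1 h2 h3 h4

theorem superAdd_eVariationOn_sub_edist (H : ℝ → E) (a b : ℝ) :
    SuperAdd a b fun u v => eVariationOn H (Icc u v) - edist (H u) (H v) :=
  SuperAdd.tsub (X := fun u v => eVariationOn H (Icc u v)) (Y := fun u v => edist (H u) (H v))
    (fun _ _ _ _ h2 h3 _ => (eVariationOn_Icc_add H h2 h3).le)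
    (fun _ _ _ _ _ _ _ => edist_triangle _ _ _)
    (fun _ _ _ h2 _ => eVariationOn.edist_le H (left_mem_Icc.2 h2) (right_mem_Icc.2 h2))
    (fun _ _ _ _ _ => edist_ne_top _ _)

theorem exists_partition_eVariationOn_le (hab : a ≤ b) (hV : eVariationOn H (Icc a b) ≠ ⊤)
    {ε : ℝ≥0∞} (hε : 0 < ε) : ∃ (p : ℕ → ℝ) (m : ℕ), Monotone p ∧ p 0 = a ∧ p m = b ∧
      eVariationOn H (Icc a b) ≤ ∑ i ∈ Finset.range m, edist (H (p i)) (H (p (i + 1))) + ε := by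
  have hlt : eVariationOn H (Icc a b) < eVariationOn H (Icc a b) + ε :=
    ENNReal.lt_add_right hV hε.ne'
  have : Nonempty (ℕ × { u : ℕ → ℝ // Monotone u ∧ ∀ i, u i ∈ Icc a b }) :=
    ⟨0, fun _ => a, monotone_const, fun _ => left_mem_Icc.2 hab⟩
  conv_rhs at hlt => rw [eVariationOn, ENNReal.iSup_add]
  obtain ⟨⟨n, u, hu, hmem⟩, h⟩ := lt_iSup_iff.1 hlt
  let p : ℕ → ℝ := fun i => if i = 0 then a else if i ≤ n + 1 then u (i - 1) else b
  have p1 : ∀ i ≤ n, p (i + 1) = u i := fun i hi => by simp [p, hi]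
  refine ⟨p, n + 2, monotone_nat_of_le_succ fun i => ?_, by simp [p], by simp [p],
    h.le.trans (add_le_add ?_ le_rfl)⟩
  · rcases i with _ | i
    · simpa [p] using (hmem 0).1
    · rcases lt_trichotomy i n with hi | rfl | hi
      · rw [p1 i hi.le, p1 (i + 1) hi]
        exact hu (Nat.le_succ i)
      · simpa [p] using (hmem i).2
      · simp [p, show ¬ i ≤ n by omega, show ¬ i + 1 ≤ n by omega]
  · rw [Finset.sum_range_succ, Finset.sum_range_succ']
    refine le_trans (Finset.sum_le_sum fun i hi => ?_) (le_self_add.trans le_self_add)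
    rw [Finset.mem_range] at hi
    rw [p1 i hi.le, p1 (i + 1) hi, edist_comm]

theorem eq_or_exists_cell {p : ℕ → ℝ} {m : ℕ} {x y : ℝ} (hxy : x ≤ y) (h0 : p 0 ≤ x)
    (hm : y ≤ p m) (h : ∀ i ≤ m, p i ≤ x ∨ y ≤ p i) :
    x = y ∨ ∃ i < m, p i ≤ x ∧ y ≤ p (i + 1) := by
  classical
  have hex : ∃ j, y ≤ p j := ⟨m, hm⟩
  rcases hj : Nat.find hex with _ | i
  · have := Nat.find_spec hex
    rw [hj] at this
    exact Or.inl (le_antisymm hxy (this.trans h0))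
  · have h1 := Nat.find_spec hex
    have h2 : ¬ y ≤ p i := Nat.find_min hex (by omega)
    have h3 := Nat.find_min' hex hm
    rw [hj] at h1 h3
    exact Or.inr ⟨i, h3, (h i (by omega)).resolve_right h2, h1⟩

theorem exists_radius_avoiding (p : ℕ → ℝ) (m : ℕ) (τ : ℝ) :
    ∃ r > 0, ∀ i ≤ m, p i ≤ τ - r ∨ p i = τ ∨ τ + r ≤ p i := by
  have key : ∀ i, ∃ r > 0, p i ≤ τ - r ∨ p i = τ ∨ τ + r ≤ p i := by
    intro i
    rcases lt_trichotomy (p i) τ with h | h | h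
    · exact ⟨τ - p i, by linarith, Or.inl (by linarith)⟩
    · exact ⟨1, one_pos, Or.inr (Or.inl h)⟩
    · exact ⟨p i - τ, by linarith, Or.inr (Or.inr (by linarith))⟩
  choose r hr h using key
  refine ⟨(Finset.range (m + 1)).inf' (by simp) r, by simpa using fun i _ => hr i,
    fun i hi => ?_⟩
  have hle := Finset.inf'_le r (Finset.mem_range.2 (Nat.lt_succ_of_le hi))
  rcases h i with h | h | h
  · exact Or.inl (by linarith)
  · exact Or.inr (Or.inl h)
  · exact Or.inr (Or.inr (by linarith))

/-- Up to a superadditive interval function of small mass, the variation of `H` over small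
intervals is given by its increments. -/
theorem exists_superAdd_eVariationOn_le (hab : a ≤ b) (hV : eVariationOn H (Icc a b) ≠ ⊤)
    {ε : ℝ≥0∞} (hε : 0 < ε) : ∃ X, SuperAdd a b X ∧ X a b ≤ ε ∧ NearTags a b fun τ u v =>
      eVariationOn H (Icc u v) ≤ edist (H u) (H τ) + edist (H τ) (H v) + X u v := by
  obtain ⟨p, m, hp, p0, pm, hsum⟩ := exists_partition_eVariationOn_le hab hV hε
  let d : ℝ → ℝ → ℝ≥0∞ := fun u v => eVariationOn H (Icc u v) - edist (H u) (H v)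
  let c : ℕ → ℝ → ℝ := fun i t => max (p i) (min t (p (i + 1)))
  have hpa : ∀ i, a ≤ p i := fun i => p0 ▸ hp (Nat.zero_le i)
  have hpb : ∀ i ≤ m, p i ≤ b := fun i hi => pm ▸ hp hi
  have hc : ∀ i, ∀ t, p i ≤ t → t ≤ p (i + 1) → c i t = t := fun i t h1 h2 => by
    simp only [c, min_eq_left h2, max_eq_right h1]
  have ca : ∀ i, c i a = p i := fun i => by
    simp only [c, min_eq_left (hpa _), max_eq_left (hpa _)]
  have cb : ∀ i < m, c i b = p (i + 1) := fun i hi => by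
    simp only [c, min_eq_right (hpb (i + 1) hi), max_eq_right (hp (Nat.le_succ i))]
  have hX : SuperAdd a b fun u v => ∑ i ∈ Finset.range m, d (c i u) (c i v) := by
    refine SuperAdd.sum _ fun i hi => ?_
    refine (superAdd_eVariationOn_sub_edist H a b).comp
      (fun x y h => max_le_max le_rfl (min_le_min_right _ h)) ?_ ?_
    · exact (hpa i).trans (le_max_left _ _)
    · exact (cb i (Finset.mem_range.1 hi)).trans_le (hpb _ (Finset.mem_range.1 hi))
  refine ⟨_, hX, ?_, ?_⟩
  · have hfin : ∑ i ∈ Finset.range m, edist (H (p i)) (H (p (i + 1))) ≠ ⊤ :=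
      ENNReal.sum_ne_top.2 fun i _ => edist_ne_top _ _
    refine (ENNReal.add_le_add_iff_left hfin).1 (le_trans (le_of_eq ?_) hsum)
    rw [← Finset.sum_add_distrib, ← p0, ← pm, ← eVariationOn.sum' H hp, p0, pm]
    refine Finset.sum_congr rfl fun i hi => ?_
    have hi' := Finset.mem_range.1 hi
    rw [ca i, cb i hi']
    exact add_tsub_cancel_of_le (eVariationOn.edist_le H (left_mem_Icc.2 (hp (Nat.le_succ i)))
      (right_mem_Icc.2 (hp (Nat.le_succ i))))
  · have key : ∀ x y, a ≤ x → x ≤ y → y ≤ b → (∀ i ≤ m, p i ≤ x ∨ y ≤ p i) →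
        eVariationOn H (Icc x y) ≤
          edist (H x) (H y) + ∑ i ∈ Finset.range m, d (c i x) (c i y) := by
      intro x y hax hxy hyb h
      rcases eq_or_exists_cell hxy (p0.trans_le hax) (hyb.trans_eq pm.symm) h with
        rfl | ⟨i, hi, h1, h2⟩
      · rw [eVariationOn.subsingleton H (by simp)]
        exact zero_le
      · have := Finset.single_le_sum (f := fun i => d (c i x) (c i y)) (fun _ _ => zero_le)
          (Finset.mem_range.2 hi)
        refine le_trans ?_ (add_le_add le_rfl this)
        simp only [d]
        rw [hc i x h1 (hxy.trans h2), hc i y (h1.trans hxy) h2]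
        exact le_add_tsub
    intro τ hτ
    obtain ⟨r, hr, h⟩ := exists_radius_avoiding p m τ
    refine ⟨r, hr, fun u v h1 h2 h3 h4 h5 h6 => ?_⟩
    have k1 := key u τ h1 h2 hτ.2 fun i hi => by
      rcases h i hi with h | h | h
      · exact Or.inl (by linarith)
      · exact Or.inr h.ge
      · exact Or.inr (by linarith)
    have k2 := key τ v hτ.1 h3 h4 fun i hi => by
      rcases h i hi with h | h | h
      · exact Or.inl (by linarith)
      · exact Or.inl h.le
      · exact Or.inr (by linarith)
    beta_reduce
    rw [← eVariationOn_Icc_add H h2 h3]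
    refine (add_le_add k1 k2).trans ?_
    rw [add_add_add_comm]
    exact add_le_add le_rfl (hX u τ v h1 h2 h3 h4)

theorem IsVarPrimitive.exists_eVariationOn_le [NormedSpace ℝ E] {f : ℝ → E} {g : ℝ → ℝ}
    (hH : IsVarPrimitive f g H a b) (hab : a ≤ b) (hg : MonotoneOn g (Icc a b))
    (hV : eVariationOn H (Icc a b) ≠ ⊤) {ε : ℝ≥0∞} (hε : 0 < ε) :
    ∃ X, SuperAdd a b X ∧ X a b ≤ ε ∧ NearTags a b fun τ u v =>
      eVariationOn H (Icc u v) ≤ ENNReal.ofReal (‖f τ‖ * (g v - g u)) + X u v := by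
  obtain ⟨X, hX, hXε, hloc⟩ := exists_superAdd_eVariationOn_le hab hV (ENNReal.half_pos hε.ne')
  obtain ⟨Y, hY, hYε, hloc'⟩ := hH (ε / 2) (ENNReal.half_pos hε.ne')
  have inc : ∀ τ u v, a ≤ u → u ≤ v → v ≤ b → ‖H v - H u - (g v - g u) • f τ‖ₑ ≤ Y u v →
      edist (H u) (H v) ≤ ENNReal.ofReal (‖f τ‖ * (g v - g u)) + Y u v := by
    intro τ u v h1 h2 h3 h
    have h0 : 0 ≤ g v - g u := sub_nonneg.2 (hg ⟨h1, h2.trans h3⟩ ⟨h1.trans h2, h3⟩ h2)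
    have e : H v - H u = (g v - g u) • f τ + (H v - H u - (g v - g u) • f τ) := by abel
    rw [edist_comm, edist_eq_enorm_sub, e]
    refine (enorm_add_le _ _).trans (add_le_add (le_of_eq ?_) h)
    rw [← ofReal_norm, norm_smul, Real.norm_of_nonneg h0, mul_comm]
  refine ⟨_, hY.add hX, (add_le_add hYε hXε).trans (ENNReal.add_halves ε).le, ?_⟩
  refine ((hloc'.split).and hloc).imp fun τ u v h1 h2 h3 h4 h => ?_
  refine h.2.trans ?_
  rw [← add_assoc]
  refine add_le_add ?_ le_rfl
  have hτ : τ ∈ Icc a b := ⟨h1.trans h2, h3.trans h4⟩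
  refine (add_le_add (inc τ u τ h1 h2 hτ.2 h.1.1) (inc τ τ v hτ.1 h3 h4 h.1.2)).trans ?_
  rw [add_add_add_comm]
  refine add_le_add (le_of_eq ?_) (hY u τ v h1 h2 h3 h4)
  rw [← ENNReal.ofReal_add]
  · congr 1
    ring
  · exact mul_nonneg (norm_nonneg _) (sub_nonneg.2 (hg ⟨h1, h2.trans hτ.2⟩ hτ h2))
  · exact mul_nonneg (norm_nonneg _) (sub_nonneg.2 (hg hτ ⟨hτ.1.trans h3, h4⟩ h3))

end Variation

section TailVariation

variable {E : Type*} [NormedAddCommGroup E] {H h : ℕ → ℝ → E} {F g : ℝ → ℝ} {a b : ℝ}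

theorem eVariationOn_le_of_edist_le {E' : Type*} [NormedAddCommGroup E'] {f : ℝ → E}
    {f' : ℝ → E'} {s : Set ℝ}
    (hf : ∀ x ∈ s, ∀ y ∈ s, x ≤ y → edist (f y) (f x) ≤ edist (f' y) (f' x)) :
    eVariationOn f s ≤ eVariationOn f' s :=
  iSup_mono fun p => Finset.sum_le_sum fun i _ =>
    hf _ (p.2.2.2 i) _ (p.2.2.2 (i + 1)) (p.2.2.1 (Nat.le_succ i))

/-- The pairwise differences of `H K, …, H (K + N - 1)`. -/
def tailDiff (H : ℕ → ℝ → E) (K N : ℕ) (t : ℝ) : Fin N × Fin N → E :=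
  fun q => H (K + q.1) t - H (K + q.2) t

/-- The joint variation on `[u, v]` of all pairwise differences of the `H k`, `k ≥ K`. -/
noncomputable def tailVariation (H : ℕ → ℝ → E) (K : ℕ) (u v : ℝ) : ℝ≥0∞ :=
  ⨆ N, eVariationOn (tailDiff H K N) (Icc u v)

theorem eVariationOn_tailDiff_mono {K K' N N' : ℕ} (h1 : K' ≤ K) (h2 : K + N ≤ K' + N')
    (s : Set ℝ) : eVariationOn (tailDiff H K N) s ≤ eVariationOn (tailDiff H K' N') s := by
  refine eVariationOn_le_of_edist_le fun x _ y _ _ => edist_pi_le_iff.2 fun q => ?_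
  have := edist_le_pi_edist (tailDiff H K' N' y) (tailDiff H K' N' x)
    (⟨K - K' + q.1, by omega⟩, ⟨K - K' + q.2, by omega⟩)
  simp only [tailDiff, show ∀ i, K' + (K - K' + i) = K + i by omega] at this ⊢
  exact this

theorem monotone_eVariationOn_tailDiff (H : ℕ → ℝ → E) (K : ℕ) (s : Set ℝ) :
    Monotone fun N => eVariationOn (tailDiff H K N) s :=
  fun _ _ hN => eVariationOn_tailDiff_mono le_rfl (by omega) s

theorem tailVariation_add (H : ℕ → ℝ → E) (K : ℕ) {u v w : ℝ} (h1 : u ≤ v) (h2 : v ≤ w) :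
    tailVariation H K u v + tailVariation H K v w = tailVariation H K u w := by
  unfold tailVariation
  rw [ENNReal.iSup_add_iSup_of_monotone (monotone_eVariationOn_tailDiff H K _)
    (monotone_eVariationOn_tailDiff H K _)]
  simp only [eVariationOn_Icc_add _ h1 h2]

theorem superAdd_tailVariation (H : ℕ → ℝ → E) (K : ℕ) (a b : ℝ) :
    SuperAdd a b (tailVariation H K) :=
  fun _ _ _ _ h2 h3 _ => (tailVariation_add H K h2 h3).le

theorem tailVariation_anti (H : ℕ → ℝ → E) (u v : ℝ) : Antitone fun K => tailVariation H K u v :=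
  fun K K' hK => iSup_le fun N =>
    (eVariationOn_tailDiff_mono hK (by omega) _).trans
      (le_iSup (fun N => eVariationOn (tailDiff H K N) (Icc u v)) (K' - K + N))

theorem edist_le_tailVariation (H : ℕ → ℝ → E) {K j l : ℕ} (hj : K ≤ j) (hl : K ≤ l) {u v : ℝ}
    (huv : u ≤ v) : ‖(H j v - H j u) - (H l v - H l u)‖ₑ ≤ tailVariation H K u v := by
  have h1 := eVariationOn.edist_le (tailDiff H K (j + l + 1)) (right_mem_Icc.2 huv)
    (left_mem_Icc.2 huv)
  have h2 := edist_le_pi_edist (tailDiff H K (j + l + 1) v) (tailDiff H K (j + l + 1) u)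
    (⟨j - K, by omega⟩, ⟨l - K, by omega⟩)
  simp only [tailDiff, Nat.add_sub_cancel' hj, Nat.add_sub_cancel' hl] at h2
  rw [edist_eq_enorm_sub, sub_sub_sub_comm] at h2
  exact h2.trans (h1.trans (le_iSup (fun N => eVariationOn (tailDiff H K N) (Icc u v)) _))

theorem tailVariation_ne_top (hF : MonotoneOn F (Icc a b)) (hab : a ≤ b)
    (hbd : ∀ k u v, a ≤ u → u ≤ v → v ≤ b → ‖H k v - H k u‖ ≤ F v - F u) (K : ℕ) :
    tailVariation H K a b ≠ ⊤ := by
  have hF2 : MonotoneOn (fun t => 2 * F t) (Icc a b) :=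
    fun x hx y hy hxy => mul_le_mul_of_nonneg_left (hF hx hy hxy) zero_le_two
  have hle : tailVariation H K a b ≤ ENNReal.ofReal (2 * F b - 2 * F a) := by
    refine iSup_le fun N => ?_
    refine (eVariationOn_le_of_edist_le (f' := fun t => 2 * F t) fun x hx y hy hxy => ?_).trans ?_
    · refine edist_pi_le_iff.2 fun q => ?_
      rw [edist_dist, edist_dist]
      refine ENNReal.ofReal_le_ofReal ?_
      simp only [tailDiff, dist_eq_norm]
      rw [sub_sub_sub_comm, Real.norm_of_nonneg (sub_nonneg.2 (hF2 hx hy hxy))]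
      refine (norm_sub_le _ _).trans ?_
      linarith [hbd (K + q.1) x y hx.1 hxy hy.2, hbd (K + q.2) x y hx.1 hxy hy.2]
    · simpa using (hF2.eVariationOn_eq (left_mem_Icc.2 hab) (right_mem_Icc.2 hab)).le
  exact ne_top_of_le_ne_top ENNReal.ofReal_ne_top hle

variable [NormedSpace ℝ E]

theorem isVarPrimitive_tailDiff (hH : ∀ k, IsVarPrimitive (h k) g (H k) a b) (K N : ℕ) :
    IsVarPrimitive (tailDiff h K N) g (tailDiff H K N) a b := by
  refine IsVarPrimitive.of_components (fun q => ContinuousLinearMap.proj q) (fun e => ?_)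
    fun q => (hH (K + q.1)).sub (hH (K + q.2))
  rw [← edist_zero_right]
  refine edist_pi_le_iff.2 fun q => ?_
  rw [Pi.zero_apply, edist_zero_right]
  exact Finset.single_le_sum (f := fun q => ‖e q‖ₑ) (fun _ _ => zero_le) (Finset.mem_univ q)

theorem exists_superAdd_tailVariation_le (hab : a ≤ b) (hg : MonotoneOn g (Icc a b))
    (hH : ∀ k, IsVarPrimitive (h k) g (H k) a b) {K : ℕ} (hV : tailVariation H K a b ≠ ⊤)
    {ε : ℝ≥0∞} (hε : 0 < ε) : ∃ X, SuperAdd a b X ∧ X a b ≤ ε ∧ NearTags a b fun τ u v =>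
      ∀ c : ℝ, (∀ j l, K ≤ j → K ≤ l → ‖h j τ - h l τ‖ ≤ c) →
        tailVariation H K u v ≤ ENNReal.ofReal (c * (g v - g u)) + X u v := by
  obtain ⟨N, hN⟩ : ∃ N, tailVariation H K a b ≤
      eVariationOn (tailDiff H K N) (Icc a b) + ε / 2 := by
    have hlt : tailVariation H K a b < tailVariation H K a b + ε / 2 :=
      ENNReal.lt_add_right hV (ENNReal.half_pos hε.ne').ne'
    conv_rhs at hlt => rw [tailVariation, ENNReal.iSup_add]
    obtain ⟨N, hN⟩ := lt_iSup_iff.1 hlt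
    exact ⟨N, hN.le⟩
  have hle : ∀ u v, eVariationOn (tailDiff H K N) (Icc u v) ≤ tailVariation H K u v :=
    fun u v => le_iSup (fun N => eVariationOn (tailDiff H K N) (Icc u v)) N
  have hfin : ∀ u v, a ≤ u → u ≤ v → v ≤ b → eVariationOn (tailDiff H K N) (Icc u v) ≠ ⊤ :=
    fun u v h1 h2 h3 => ne_top_of_le_ne_top hV
      ((hle u v).trans ((superAdd_tailVariation H K a b).mono_interval h1 h2 h3))
  obtain ⟨X, hX, hXε, hloc⟩ := (isVarPrimitive_tailDiff hH K N).exists_eVariationOn_le hab hg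
    (hfin a b le_rfl hab le_rfl) (ENNReal.half_pos hε.ne')
  have hY := (superAdd_tailVariation H K a b).tsub
    (Y := fun u v => eVariationOn (tailDiff H K N) (Icc u v))
    (fun _ _ _ _ h2 h3 _ => (eVariationOn_Icc_add _ h2 h3).ge) (fun u v _ _ _ => hle u v) hfin
  refine ⟨_, hX.add hY, (add_le_add hXε (?_ : _ ≤ ε / 2)).trans (ENNReal.add_halves ε).le,
    hloc.imp fun τ u v h1 h2 h3 h4 k c hc => ?_⟩
  · exact tsub_le_iff_left.2 hN
  · have hc0 : 0 ≤ c := (norm_nonneg _).trans (hc K K le_rfl le_rfl)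
    have hn : ‖tailDiff h K N τ‖ ≤ c :=
      (pi_norm_le_iff_of_nonneg hc0).2 fun q => hc _ _ (by omega) (by omega)
    have h0 : 0 ≤ g v - g u :=
      sub_nonneg.2 (hg ⟨h1, h2.trans (h3.trans h4)⟩ ⟨h1.trans (h2.trans h3), h4⟩ (h2.trans h3))
    calc tailVariation H K u v ≤ eVariationOn (tailDiff H K N) (Icc u v) +
          (tailVariation H K u v - eVariationOn (tailDiff H K N) (Icc u v)) := le_add_tsub
      _ ≤ _ := by
        rw [← add_assoc]
        refine add_le_add (k.trans (add_le_add ?_ le_rfl)) le_rfl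
        exact ENNReal.ofReal_le_ofReal (mul_le_mul_of_nonneg_right hn h0)

theorem exists_pos_ofReal_mul_le (x : ℝ) {ε : ℝ≥0∞} (hε : 0 < ε) :
    ∃ η : ℝ, 0 < η ∧ ENNReal.ofReal (η * x) ≤ ε := by
  obtain ⟨r, hr, hrε⟩ := exists_pos_ofReal_le hε
  have hx : 0 < |x| + 1 := by positivity
  refine ⟨r / (|x| + 1), by positivity, le_trans (ENNReal.ofReal_le_ofReal ?_) hrε⟩
  rw [div_mul_eq_mul_div, div_le_iff₀ hx]
  exact mul_le_mul_of_nonneg_left (by linarith [le_abs_self x]) hr.le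

theorem superAdd_ofReal_mul_sub (hg : MonotoneOn g (Icc a b)) {η : ℝ} (hη : 0 ≤ η) :
    SuperAdd a b fun u v => ENNReal.ofReal (η * (g v - g u)) := by
  simp only [mul_sub]
  exact superAdd_ofReal_sub (G := fun t => η * g t)
    fun x hx y hy hxy => mul_le_mul_of_nonneg_left (hg hx hy hxy) hη

theorem iInf_tailVariation_eq_zero {f : ℝ → E} (hab : a ≤ b) (hg : MonotoneOn g (Icc a b))
    (hH : ∀ k, IsVarPrimitive (h k) g (H k) a b) (hV : ∀ K, tailVariation H K a b ≠ ⊤)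
    (hlim : ∀ τ ∈ Icc a b, Tendsto (fun k => h k τ) atTop (𝓝 (f τ))) :
    ⨅ K, tailVariation H K a b = 0 := by
  refine le_antisymm (le_of_forall_gt_imp_ge_of_dense fun ε hε => ?_) zero_le
  obtain ⟨η, hη, hηε⟩ := exists_pos_ofReal_mul_le (g b - g a) (ENNReal.half_pos hε.ne')
  obtain ⟨e, he, hesum⟩ := ENNReal.exists_pos_sum_of_countable' (ENNReal.half_pos hε.ne').ne' ℕ
  choose X hX hXe hloc using fun K => exists_superAdd_tailVariation_le hab hg hH (hV K) (he K)
  have hY := (superAdd_ofReal_mul_sub hg hη.le).add (SuperAdd.tsum hX)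
  refine (NearTags.le_of_superAdd (Φ := fun u v => ⨅ K, tailVariation H K u v) hab ?_ hY ?_).trans
    ((add_le_add hηε ((ENNReal.tsum_le_tsum hXe).trans hesum.le)).trans (ENNReal.add_halves ε).le)
  · intro τ hτ
    obtain ⟨K, hK⟩ := Metric.cauchySeq_iff.1 (hlim τ hτ).cauchySeq η hη
    obtain ⟨r, hr, k⟩ := hloc K τ hτ
    refine ⟨r, hr, fun u v h1 h2 h3 h4 h5 h6 => ?_⟩
    refine (iInf_le _ K).trans ((k u v h1 h2 h3 h4 h5 h6 η fun j l hj hl => ?_).trans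
      (add_le_add le_rfl (ENNReal.le_tsum K)))
    rw [← dist_eq_norm]
    exact (hK j hj l hl).le
  · intro u v w _ h2 h3 _
    rw [ENNReal.iInf_add_iInf fun i j => ⟨max i j, add_le_add
      (tailVariation_anti H u v (le_max_left i j)) (tailVariation_anti H v w (le_max_right i j))⟩]
    simp only [tailVariation_add H _ h2 h3]
    exact le_rfl

/-- Dominated convergence for variational primitives. -/
theorem exists_isVarPrimitive_of_tendsto [CompleteSpace E] {f : ℝ → E} (hab : a ≤ b)
    (hg : MonotoneOn g (Icc a b)) (hF : MonotoneOn F (Icc a b))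
    (hH : ∀ k, IsVarPrimitive (h k) g (H k) a b)
    (hbd : ∀ k u v, a ≤ u → u ≤ v → v ≤ b → ‖H k v - H k u‖ ≤ F v - F u)
    (hlim : ∀ τ ∈ Icc a b, Tendsto (fun k => h k τ) atTop (𝓝 (f τ))) :
    ∃ H' : ℝ → E, IsVarPrimitive f g H' a b ∧
      ∀ u v, a ≤ u → u ≤ v → v ≤ b → ‖H' v - H' u‖ ≤ F v - F u := by
  have hW := iInf_tailVariation_eq_zero hab hg hH (tailVariation_ne_top hF hab hbd) hlim
  have small : ∀ ε : ℝ≥0∞, 0 < ε → ∃ K, tailVariation H K a b < ε := fun ε hε =>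
    iInf_lt_iff.1 (hW.trans_lt hε)
  have hcauchy : ∀ t ∈ Icc a b, CauchySeq fun k => H k t - H k a := by
    intro t ht
    refine EMetric.cauchySeq_iff.2 fun ε hε => ?_
    obtain ⟨K, hK⟩ := small ε hε
    refine ⟨K, fun j hj l hl => ?_⟩
    rw [edist_eq_enorm_sub]
    exact (edist_le_tailVariation H hj hl ht.1).trans_lt
      (((superAdd_tailVariation H K a b).mono_interval le_rfl ht.1 ht.2).trans_lt hK)
  let H' : ℝ → E := fun t => limUnder atTop fun k => H k t - H k a
  have hlimH : ∀ u v, a ≤ u → u ≤ v → v ≤ b →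
      Tendsto (fun k => H k v - H k u) atTop (𝓝 (H' v - H' u)) := by
    intro u v h1 h2 h3
    refine ((CauchySeq.tendsto_limUnder (hcauchy v ⟨h1.trans h2, h3⟩)).sub
      (CauchySeq.tendsto_limUnder (hcauchy u ⟨h1, h2.trans h3⟩))).congr fun k => ?_
    abel
  have hclose : ∀ k u v, a ≤ u → u ≤ v → v ≤ b →
      ‖(H' v - H' u) - (H k v - H k u)‖ₑ ≤ tailVariation H k u v := by
    intro k u v h1 h2 h3
    refine le_of_tendsto ((hlimH u v h1 h2 h3).sub_const (H k v - H k u)).enorm ?_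
    filter_upwards [eventually_ge_atTop k] with j hj
    exact edist_le_tailVariation H hj le_rfl h2
  refine ⟨H', fun ε hε => ?_, fun u v h1 h2 h3 => le_of_tendsto (hlimH u v h1 h2 h3).norm
    (Eventually.of_forall fun k => hbd k u v h1 h2 h3)⟩
  have hε3 : 0 < ε / 3 := ENNReal.div_pos hε.ne' (by simp)
  obtain ⟨K, hK⟩ := small _ hε3
  obtain ⟨η, hη, hηε⟩ := exists_pos_ofReal_mul_le (g b - g a) hε3
  obtain ⟨e, he, hesum⟩ := ENNReal.exists_pos_sum_of_countable' hε3.ne' ℕ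
  choose X hX hXe hloc using fun k => hH k (e k) (he k)
  refine ⟨_, ((superAdd_tailVariation H K a b).add (SuperAdd.tsum hX)).add
    (superAdd_ofReal_mul_sub hg hη.le), ?_, ?_⟩
  · exact (add_le_add (add_le_add hK.le ((ENNReal.tsum_le_tsum hXe).trans hesum.le)) hηε).trans
      (ENNReal.add_thirds ε).le
  · intro τ hτ
    obtain ⟨k, hkK, hk⟩ := ((eventually_ge_atTop K).and
      ((hlim τ hτ).eventually (Metric.closedBall_mem_nhds _ hη))).exists
    obtain ⟨r, hr, hX'⟩ := hloc k τ hτ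
    refine ⟨r, hr, fun u v h1 h2 h3 h4 h5 h6 => ?_⟩
    have h0 : 0 ≤ g v - g u :=
      sub_nonneg.2 (hg ⟨h1, h2.trans (h3.trans h4)⟩ ⟨h1.trans (h2.trans h3), h4⟩ (h2.trans h3))
    have e1 : H' v - H' u - (g v - g u) • f τ = ((H' v - H' u) - (H k v - H k u)) +
        (H k v - H k u - (g v - g u) • h k τ) + (g v - g u) • (h k τ - f τ) := by
      rw [smul_sub]
      abel
    beta_reduce
    rw [e1]
    refine (enorm_add_le _ _).trans (add_le_add ((enorm_add_le _ _).trans (add_le_add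
      ((hclose k u v h1 (h2.trans h3) h4).trans (tailVariation_anti H u v hkK))
      ((hX' u v h1 h2 h3 h4 h5 h6).trans (ENNReal.le_tsum k)))) ?_)
    rw [← ofReal_norm, norm_smul, Real.norm_of_nonneg h0, mul_comm]
    refine ENNReal.ofReal_le_ofReal (mul_le_mul_of_nonneg_right ?_ h0)
    rwa [← dist_eq_norm]

end TailVariation

section LeftLimits

variable {E : Type*} [NormedAddCommGroup E] {x : ℝ → E} {a b : ℝ}

/-- A function with left limits has at most countably many left discontinuities. -/
theorem countable_left_discontinuities
    (hx : ∀ t ∈ Ioc a b, ∃ L, Tendsto x (𝓝[<] t) (𝓝 L)) :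
    {t | t ∈ Ioc a b ∧ ¬ Tendsto x (𝓝[<] t) (𝓝 (x t))}.Countable := by
  let D : ℕ → Set ℝ := fun m => {t | t ∈ Ioc a b ∧
    ∃ L, Tendsto x (𝓝[<] t) (𝓝 L) ∧ 1 / ((m : ℝ) + 1) < dist (x t) L}
  have hD : ∀ m, (D m).Countable := by
    intro m
    suffices D m ⊆ {t ∈ D m | 𝓝[D m ∩ Iio t] t = ⊥} from
      countable_setOfPred_isolated_left_within.mono this
    refine fun t ht => mem_sep ht ?_
    obtain ⟨⟨hat, htb⟩, L, hL, -⟩ := ht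
    have hm : (0 : ℝ) < 1 / ((m : ℝ) + 1) / 2 := by positivity
    obtain ⟨l, hl, hsub⟩ := (mem_nhdsLT_iff_exists_Ioo_subset).1
      (hL.eventually (Metric.closedBall_mem_nhds L hm))
    refine empty_mem_iff_bot.1 (mem_nhdsWithin.2 ⟨Ioi l, isOpen_Ioi, hl, fun s hs => ?_⟩)
    obtain ⟨hls, ⟨-, L', hL', hdist⟩, hst⟩ := hs
    replace hls : l < s := hls
    replace hst : s < t := hst
    exfalso
    have h1 : dist L' L ≤ 1 / ((m : ℝ) + 1) / 2 := by
      refine le_of_tendsto (hL'.dist tendsto_const_nhds) ?_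
      filter_upwards [Ioo_mem_nhdsLT hls] with z hz
      exact hsub ⟨hz.1, hz.2.trans hst⟩
    have h2 : dist (x s) L ≤ 1 / ((m : ℝ) + 1) / 2 := hsub ⟨hls, hst⟩
    linarith [dist_triangle_right (x s) L' L]
  refine (countable_iUnion hD).mono fun t ht => ?_
  obtain ⟨L, hL⟩ := hx t ht.1
  have hne : x t ≠ L := fun h => ht.2 (h ▸ hL)
  obtain ⟨m, hm⟩ := exists_nat_one_div_lt (dist_pos.2 hne)
  exact mem_iUnion.2 ⟨m, ht.1, L, hL, hm⟩

/-- The largest of `a, c 0, …, c (k - 1)` not exceeding `s`. -/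
noncomputable def stepPoint (a : ℝ) (c : ℕ → ℝ) : ℕ → ℝ → ℝ
  | 0, _ => a
  | k + 1, s => if c k ≤ s then max (stepPoint a c k s) (c k) else stepPoint a c k s

theorem stepPoint_le (c : ℕ → ℝ) (k : ℕ) {s : ℝ} (h : a ≤ s) : stepPoint a c k s ≤ s := by
  induction k with
  | zero => exact h
  | succ k ih =>
    rw [stepPoint]
    split_ifs with hc
    · exact max_le ih hc
    · exact ih

theorem le_stepPoint_of_lt {c : ℕ → ℝ} {i k : ℕ} (hik : i < k) {s : ℝ} (h : c i ≤ s) :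
    c i ≤ stepPoint a c k s := by
  induction k with
  | zero => omega
  | succ k ih =>
    rw [stepPoint]
    rcases Nat.lt_succ_iff_lt_or_eq.1 hik with hi | rfl
    · split_ifs
      · exact (ih hi).trans (le_max_left _ _)
      · exact ih hi
    · rw [if_pos h]
      exact le_max_right _ _

theorem stepPoint_locally_const (a : ℝ) (c : ℕ → ℝ) (k : ℕ) (τ : ℝ) :
    ∃ r > 0, (∀ s, τ ≤ s → s < τ + r → stepPoint a c k s = stepPoint a c k τ) ∧
      ∃ d, ∀ s, τ - r < s → s < τ → stepPoint a c k s = d := by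
  induction k with
  | zero => exact ⟨1, one_pos, fun _ _ _ => rfl, a, fun _ _ _ => rfl⟩
  | succ k ih =>
    obtain ⟨r, hr, h1, d, h2⟩ := ih
    simp only [stepPoint]
    rcases lt_trichotomy (c k) τ with h | h | h
    · refine ⟨min r (τ - c k), lt_min hr (sub_pos.2 h), fun s k1 k2 => ?_, max d (c k),
        fun s k1 k2 => ?_⟩
      · rw [if_pos (h.le.trans k1), if_pos h.le,
          h1 s k1 (by linarith [min_le_left r (τ - c k)])]
      · rw [if_pos (by linarith [min_le_right r (τ - c k)]),
          h2 s (by linarith [min_le_left r (τ - c k)]) k2]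
    · refine ⟨r, hr, fun s k1 k2 => ?_, d, fun s k1 k2 => ?_⟩
      · rw [if_pos (h.le.trans k1), if_pos h.le, h1 s k1 k2]
      · rw [if_neg (by linarith), h2 s k1 k2]
    · refine ⟨min r (c k - τ), lt_min hr (sub_pos.2 h), fun s k1 k2 => ?_, d, fun s k1 k2 => ?_⟩
      · rw [if_neg (by linarith [min_le_right r (c k - τ)]), if_neg (by linarith),
          h1 s k1 (by linarith [min_le_left r (c k - τ)])]
      · rw [if_neg (by linarith), h2 s (by linarith [min_le_left r (c k - τ)]) k2]

theorem exists_tendsto_stepPoint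
    (hx : ∀ t ∈ Ioc a b, ∃ L, Tendsto x (𝓝[<] t) (𝓝 L)) :
    ∃ c : ℕ → ℝ, ∀ s ∈ Icc a b, Tendsto (fun k => x (stepPoint a c k s)) atTop (𝓝 (x s)) := by
  obtain ⟨Q, hQc, hQ⟩ := TopologicalSpace.exists_countable_dense ℝ
  have hC := ((hQc.union (countable_left_discontinuities hx)).union (countable_singleton a))
  obtain ⟨c, hc⟩ := hC.exists_eq_range ⟨a, Or.inr rfl⟩
  refine ⟨c, fun s hs => ?_⟩
  by_cases hsC : s ∈ range c
  · obtain ⟨i, rfl⟩ := hsC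
    refine tendsto_const_nhds.congr' ?_
    filter_upwards [eventually_gt_atTop i] with k hk
    rw [le_antisymm (stepPoint_le c k hs.1) (le_stepPoint_of_lt hk le_rfl)]
  · rw [← hc] at hsC
    have has : a < s := lt_of_le_of_ne hs.1 fun h => hsC (Or.inr h.symm)
    have hcont : Tendsto x (𝓝[<] s) (𝓝 (x s)) := by
      by_contra h
      exact hsC (Or.inl (Or.inr ⟨⟨has, hs.2⟩, h⟩))
    have hcont' : ContinuousWithinAt x (Iic s) s :=
      continuousWithinAt_Iio_iff_Iic.1 hcont
    refine Tendsto.comp (y := 𝓝[Iic s] s) hcont' (tendsto_nhdsWithin_iff.2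
      ⟨tendsto_order.2 ⟨fun l hl => ?_, fun l hl => ?_⟩, ?_⟩)
    · obtain ⟨q, hqQ, hlq, hqs⟩ := hQ.exists_between hl
      obtain ⟨i, rfl⟩ : q ∈ range c := hc ▸ Or.inl (Or.inl hqQ)
      filter_upwards [eventually_gt_atTop i] with k hk
      exact hlq.trans_le (le_stepPoint_of_lt hk hqs.le)
    · exact Eventually.of_forall fun k => (stepPoint_le c k hs.1).trans_lt hl
    · exact Eventually.of_forall fun k => stepPoint_le c k hs.1

end LeftLimits

section Superposition

variable {E : Type*} [NormedAddCommGroup E] [NormedSpace ℝ E] {g F : ℝ → ℝ} {f : ℝ → E → E}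
  {a b : ℝ}

theorem exists_isVarPrimitive_concat {f : ℝ → E} {H H' : ℝ → E} {u τ v : ℝ} (h1 : u ≤ τ)
    (h2 : τ ≤ v) (hH : IsVarPrimitive f g H u τ) (hH' : IsVarPrimitive f g H' τ v)
    (hF : ∀ s t, u ≤ s → s ≤ t → t ≤ τ → ‖H t - H s‖ ≤ F t - F s)
    (hF' : ∀ s t, τ ≤ s → s ≤ t → t ≤ v → ‖H' t - H' s‖ ≤ F t - F s) :
    ∃ K : ℝ → E, IsVarPrimitive f g K u v ∧
      ∀ s t, u ≤ s → s ≤ t → t ≤ v → ‖K t - K s‖ ≤ F t - F s := by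
  refine ⟨_, hH.concat h1 h2 hH', fun s t k1 k2 k3 => ?_⟩
  have e : ∀ t, F (min t τ) + F (max t τ) = F t + F τ := fun t => by
    rcases le_total t τ with h | h
    · rw [min_eq_left h, max_eq_right h]
    · rw [min_eq_right h, max_eq_left h, add_comm]
  rw [add_sub_add_comm]
  refine (norm_add_le _ _).trans ?_
  linarith [hF (min s τ) (min t τ) (le_min k1 h1) (min_le_min_right _ k2) (min_le_right _ _),
    hF' (max s τ) (max t τ) (le_max_right _ _) (max_le_max_right _ k2) (max_le k3 h2), e s, e t]

theorem exists_isVarPrimitive_of_locally_const (hab : a ≤ b)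
    (hg : ∀ t ∈ Ioc a b, Tendsto g (𝓝[<] t) (𝓝 (g t))) {H : E → ℝ → E}
    (hH : ∀ w, IsVarPrimitive (fun s => f s w) g (H w) a b)
    (hbd : ∀ w u v, a ≤ u → u ≤ v → v ≤ b → ‖H w v - H w u‖ ≤ F v - F u) {y : ℝ → E}
    (hy : ∀ τ, ∃ r > 0, (∀ s, τ ≤ s → s < τ + r → y s = y τ) ∧
      ∃ w, ∀ s, τ - r < s → s < τ → y s = w) :
    ∃ K : ℝ → E, IsVarPrimitive (fun s => f s (y s)) g K a b ∧
      ∀ u v, a ≤ u → u ≤ v → v ≤ b → ‖K v - K u‖ ≤ F v - F u := by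
  refine NearTags.induction (R := fun c d => ∃ K : ℝ → E,
    IsVarPrimitive (fun s => f s (y s)) g K c d ∧
      ∀ u v, c ≤ u → u ≤ v → v ≤ d → ‖K v - K u‖ ≤ F v - F u) hab ?_ ?_
  · intro τ hτ
    obtain ⟨r, hr, h1, w, h2⟩ := hy τ
    refine ⟨r, hr, fun u v k1 k2 k3 k4 k5 k6 => ?_⟩
    refine exists_isVarPrimitive_concat k2 k3
      (((hH w).restrict k1 k2 hτ.2).congr_Ico (fun t ht => ?_)
        fun h => hg τ ⟨k1.trans_lt h, hτ.2⟩)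
      (((hH (y τ)).restrict hτ.1 k3 k4).congr_Ico (fun t ht => ?_)
        fun h => hg v ⟨hτ.1.trans_lt h, k4⟩)
      (fun s t l1 l2 l3 => hbd w s t (k1.trans l1) l2 (l3.trans hτ.2))
      (fun s t l1 l2 l3 => hbd (y τ) s t (hτ.1.trans l1) l2 (l3.trans k4))
    · rw [h2 t (k5.trans_le ht.1) ht.2]
    · rw [h1 t ht.1 (ht.2.trans k6)]
  · rintro u v w - h2 h3 - ⟨K, hK, hK'⟩ ⟨L, hL, hL'⟩
    exact exists_isVarPrimitive_concat h2 h3 hK hL hK' hL'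

theorem exists_isVarPrimitive_superposition [CompleteSpace E] (hab : a ≤ b)
    (hg : MonotoneOn g (Icc a b)) (hg' : ∀ t ∈ Ioc a b, Tendsto g (𝓝[<] t) (𝓝 (g t)))
    (hF : MonotoneOn F (Icc a b)) (hf : ∀ t ∈ Icc a b, Continuous (f t)) {H : E → ℝ → E}
    (hH : ∀ w, IsVarPrimitive (fun s => f s w) g (H w) a b)
    (hbd : ∀ w u v, a ≤ u → u ≤ v → v ≤ b → ‖H w v - H w u‖ ≤ F v - F u) {x : ℝ → E}
    (hx : ∀ t ∈ Ioc a b, ∃ L, Tendsto x (𝓝[<] t) (𝓝 L)) :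
    ∃ K : ℝ → E, IsVarPrimitive (fun s => f s (x s)) g K a b ∧
      ∀ u v, a ≤ u → u ≤ v → v ≤ b → ‖K v - K u‖ ≤ F v - F u := by
  obtain ⟨c, hc⟩ := exists_tendsto_stepPoint hx
  have step : ∀ k, ∃ K : ℝ → E,
      IsVarPrimitive (fun s => f s (x (stepPoint a c k s))) g K a b ∧
        ∀ u v, a ≤ u → u ≤ v → v ≤ b → ‖K v - K u‖ ≤ F v - F u := by
    intro k
    refine exists_isVarPrimitive_of_locally_const hab hg' hH hbd fun τ => ?_
    obtain ⟨r, hr, h1, d, h2⟩ := stepPoint_locally_const a c k τ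
    exact ⟨r, hr, fun s k1 k2 => by rw [h1 s k1 k2], x d, fun s k1 k2 => by rw [h2 s k1 k2]⟩
  choose K hK hK' using step
  exact exists_isVarPrimitive_of_tendsto hab hg hF hK hK' fun τ hτ =>
    ((hf τ hτ).tendsto _).comp (hc τ hτ)

end Superposition

section MonotoneControl

variable {E : Type*} [NormedAddCommGroup E] {F : ℝ → ℝ} {a b : ℝ}

theorem equiregulatedOn_of_norm_sub_le (hF : MonotoneOn F (Icc a b)) {Y : Set (ℝ → E)}
    (hY : ∀ y ∈ Y, ∀ u v, a ≤ u → u ≤ v → v ≤ b → ‖y v - y u‖ ≤ F v - F u) :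
    EquiregulatedOn Y a b := by
  refine fun ε hε => ⟨fun τ hτ => ?_, fun τ hτ => ?_⟩
  · have hbdd : BddAbove (F '' Ico a τ) := by
      refine ⟨F b, ?_⟩
      rintro _ ⟨s, hs, rfl⟩
      exact hF ⟨hs.1, hs.2.le.trans hτ.2⟩ ⟨hτ.1.le.trans hτ.2, le_rfl⟩ (hs.2.le.trans hτ.2)
    obtain ⟨_, ⟨s, hs, rfl⟩, hsS⟩ := exists_lt_of_lt_csSup (s := F '' Ico a τ)
      ⟨_, mem_image_of_mem F (left_mem_Ico.2 hτ.1)⟩ (sub_lt_self _ (half_pos hε))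
    refine ⟨τ - s, sub_pos.2 hs.2, fun y hy L hL t ht hst => ?_⟩
    rw [nhdsWithin_Ico_eq_nhdsLT hτ.1] at hL
    have hst' : s < t := by linarith
    refine lt_of_le_of_lt (le_of_tendsto (tendsto_const_nhds.sub hL).norm
      (?_ : ∀ᶠ r in 𝓝[<] τ, ‖y t - y r‖ ≤ ε / 2)) (half_lt_self hε)
    filter_upwards [Ioo_mem_nhdsLT ht.2] with r hr
    have hrm : r ∈ Ico a τ := ⟨ht.1.trans hr.1.le, hr.2⟩
    have h1 := hY y hy t r ht.1 hr.1.le (hr.2.le.trans hτ.2)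
    have h2 := le_csSup hbdd (mem_image_of_mem F hrm)
    have h3 := hF ⟨hs.1, hs.2.le.trans hτ.2⟩ ⟨ht.1, ht.2.le.trans hτ.2⟩ hst'.le
    rw [norm_sub_rev]
    linarith
  · have hbdd : BddBelow (F '' Ioc τ b) := by
      refine ⟨F a, ?_⟩
      rintro _ ⟨s, hs, rfl⟩
      exact hF ⟨le_rfl, hτ.1.trans hτ.2.le⟩ ⟨hτ.1.trans hs.1.le, hs.2⟩ (hτ.1.trans hs.1.le)
    obtain ⟨_, ⟨s, hs, rfl⟩, hsS⟩ := exists_lt_of_csInf_lt (s := F '' Ioc τ b)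
      ⟨_, mem_image_of_mem F (right_mem_Ioc.2 hτ.2)⟩ (lt_add_of_pos_right _ (half_pos hε))
    refine ⟨s - τ, sub_pos.2 hs.1, fun y hy L hL t ht hst => ?_⟩
    rw [nhdsWithin_Ioc_eq_nhdsGT hτ.2] at hL
    have hst' : t < s := by linarith
    refine lt_of_le_of_lt (le_of_tendsto (tendsto_const_nhds.sub hL).norm
      (?_ : ∀ᶠ r in 𝓝[>] τ, ‖y t - y r‖ ≤ ε / 2)) (half_lt_self hε)
    filter_upwards [Ioo_mem_nhdsGT ht.1] with r hr
    have hrm : r ∈ Ioc τ b := ⟨hr.1, hr.2.le.trans ht.2⟩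
    have h1 := hY y hy r t (hτ.1.trans hr.1.le) hr.2.le ht.2
    have h2 := csInf_le hbdd (mem_image_of_mem F hrm)
    have h3 := hF ⟨hτ.1.trans ht.1.le, ht.2⟩ ⟨hτ.1.trans hs.1.le, hs.2⟩ hst'.le
    linarith

theorem norm_sub_le_abs_sub {y : ℝ → E}
    (hy : ∀ u v, a ≤ u → u ≤ v → v ≤ b → ‖y v - y u‖ ≤ F v - F u) {u v : ℝ} (hu : u ∈ Icc a b)
    (hv : v ∈ Icc a b) : ‖y v - y u‖ ≤ |F v - F u| := by
  rcases le_total u v with h | h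
  · exact (hy u v hu.1 h hv.2).trans (le_abs_self _)
  · rw [norm_sub_rev, abs_sub_comm]
    exact (hy v u hv.1 h hu.2).trans (le_abs_self _)

theorem exists_lipschitzWith_comp_eq [NormedSpace ℝ E] [FiniteDimensional ℝ E] {y : ℝ → E}
    (hy : ∀ u v, a ≤ u → u ≤ v → v ≤ b → ‖y v - y u‖ ≤ F v - F u) :
    ∃ z : ℝ → E, LipschitzWith (lipschitzExtensionConstant E * 1) z ∧
      ∀ t ∈ Icc a b, z (F t) = y t := by
  let φ := Function.invFunOn F (Icc a b)
  have hφ : ∀ p ∈ F '' Icc a b, φ p ∈ Icc a b ∧ F (φ p) = p := fun p hp =>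
    ⟨Function.invFunOn_mem hp, Function.invFunOn_eq hp⟩
  have hlip : LipschitzOnWith 1 (y ∘ φ) (F '' Icc a b) := by
    refine LipschitzOnWith.of_dist_le_mul fun p hp q hq => ?_
    have := norm_sub_le_abs_sub hy (hφ q hq).1 (hφ p hp).1
    rw [(hφ q hq).2, (hφ p hp).2] at this
    simpa [dist_eq_norm] using this
  obtain ⟨z, hz, hzeq⟩ := hlip.extend_finite_dimension
  refine ⟨z, hz, fun t ht => ?_⟩
  have hp := mem_image_of_mem F ht
  rw [← hzeq hp]
  have := norm_sub_le_abs_sub hy ht (hφ _ hp).1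
  rw [(hφ _ hp).2, sub_self, abs_zero, norm_le_zero_iff, sub_eq_zero] at this
  exact this

/-- Helly-type selection: functions vanishing at `a` whose increments are controlled by those of a
common monotone function have a uniformly convergent subsequence. -/
theorem exists_subseq_tendstoUniformlyOn [NormedSpace ℝ E] [FiniteDimensional ℝ E] (hab : a ≤ b)
    (hF : MonotoneOn F (Icc a b)) {y : ℕ → ℝ → E} (hy0 : ∀ k, y k a = 0)
    (hy : ∀ k u v, a ≤ u → u ≤ v → v ≤ b → ‖y k v - y k u‖ ≤ F v - F u) :
    ∃ ψ : ℕ → ℕ, StrictMono ψ ∧ ∃ y' : ℝ → E,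
      TendstoUniformlyOn (fun j => y (ψ j)) y' atTop (Icc a b) := by
  choose z hz hzy using fun k => exists_lipschitzWith_comp_eq (hy k)
  have ha : a ∈ Icc a b := left_mem_Icc.2 hab
  have hb : b ∈ Icc a b := right_mem_Icc.2 hab
  have hFm : ∀ t ∈ Icc a b, F t ∈ Icc (F a) (F b) := fun t ht =>
    ⟨hF ha ht ht.1, hF ht hb ht.2⟩
  set C := lipschitzExtensionConstant E * 1
  let Z : ℕ → BoundedContinuousFunction (Icc (F a) (F b)) E := fun k =>
    BoundedContinuousFunction.mkOfCompact
      ⟨fun p => z k p, (hz k).continuous.comp continuous_subtype_val⟩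
  have hZ : ∀ k p, Z k p = z k p := fun _ _ => rfl
  have hcpt : IsCompact (closure (range Z)) := by
    refine BoundedContinuousFunction.arzela_ascoli (Metric.closedBall 0 (C * (F b - F a)))
      (ProperSpace.isCompact_closedBall _ _) _ ?_ ?_
    · rintro _ p ⟨k, rfl⟩
      rw [mem_closedBall_zero_iff, hZ]
      have h1 := (hz k).dist_le_mul p (F a)
      rw [hzy k a ha, hy0, dist_zero_right, Real.dist_eq, abs_of_nonneg (sub_nonneg.2 p.2.1)] at h1
      exact h1.trans (mul_le_mul_of_nonneg_left (by linarith [p.2.2]) C.2)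
    · refine (LipschitzWith.uniformEquicontinuous _ C ?_).equicontinuous
      rintro ⟨_, k, rfl⟩
      exact LipschitzWith.of_dist_le_mul fun p q => (hz k).dist_le_mul p q
  obtain ⟨G, -, ψ, hψ, hG⟩ := hcpt.tendsto_subseq fun k => subset_closure (mem_range_self k)
  rw [BoundedContinuousFunction.tendsto_iff_tendstoUniformly, Metric.tendstoUniformly_iff] at hG
  refine ⟨ψ, hψ, fun t => G (projIcc (F a) (F b) (hF ha hb hab) (F t)), ?_⟩
  refine Metric.tendstoUniformlyOn_iff.2 fun ε hε => ?_
  filter_upwards [hG ε hε] with j hj t ht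
  have := hj ⟨F t, hFm t ht⟩
  rw [Function.comp_apply, hZ, hzy (ψ j) t ht] at this
  rwa [projIcc_of_mem _ (hFm t ht)]

end MonotoneControl

end HMDEPaper

namespace HMDEPaper

/-- under (A0)–(A2), the operator `Bx(t) = ∫_{t₀}^t f(s, x(s)) dg(s)` is
well defined on regulated functions, uniformly bounded, and its range is equiregulated;
consequently images of bounded sets are relatively (sequentially) compact for the sup
norm on `J`. -/
theorem operator_B_welldefined_bounded_equiregulated_compact
    {n : ℕ} (t₀ a : ℝ) (ha : 0 < a)
    (g : ℝ → ℝ) (hg_mono : MonotoneOn g (Set.Icc t₀ (t₀ + a)))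
    (hg_lc : LeftContinuousOn g t₀ (t₀ + a))
    (f : ℝ → En n → En n)
    (A0 : ∀ t ∈ Set.Icc t₀ (t₀ + a), Continuous (f t))
    (A1 : ∀ u : En n, KSIntegrable (fun s => f s u) g t₀ (t₀ + a))
    (M : ℝ → ℝ)
    (hM_nonneg : ∀ s ∈ Set.Icc t₀ (t₀ + a), 0 ≤ M s)
    (hM_int : KSIntegrable M g t₀ (t₀ + a))
    (A2 : ∀ (u : En n) (c d : ℝ), t₀ ≤ c → c ≤ d → d ≤ t₀ + a →
      ∀ (If : En n) (Im : ℝ), HasKSIntegral (fun s => f s u) g c d If →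
        HasKSIntegral M g c d Im → ‖If‖ ≤ Im) :
    ∃ B : (ℝ → En n) → (ℝ → En n),
      (∀ x : ℝ → En n, RegulatedOn x t₀ (t₀ + a) →
        ∀ t ∈ Set.Icc t₀ (t₀ + a),
          HasKSIntegral (fun s => f s (x s)) g t₀ t (B x t)) ∧
      (∀ IM : ℝ, HasKSIntegral M g t₀ (t₀ + a) IM →
        ∀ x : ℝ → En n, RegulatedOn x t₀ (t₀ + a) →
          ∀ t ∈ Set.Icc t₀ (t₀ + a), ‖B x t‖ ≤ IM) ∧
      EquiregulatedOn
        {y : ℝ → En n | ∃ x : ℝ → En n, RegulatedOn x t₀ (t₀ + a) ∧ y = B x}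
        t₀ (t₀ + a) ∧
      (∀ xs : ℕ → ℝ → En n, (∀ k, RegulatedOn (xs k) t₀ (t₀ + a)) →
        (∃ C : ℝ, ∀ k, ∀ t ∈ Set.Icc t₀ (t₀ + a), ‖xs k t‖ ≤ C) →
        ∃ ψ : ℕ → ℕ, StrictMono ψ ∧ ∃ y : ℝ → En n,
          TendstoUniformlyOn (fun j => B (xs (ψ j))) y Filter.atTop
            (Set.Icc t₀ (t₀ + a))) := by
  have hab : t₀ ≤ t₀ + a := by linarith
  have hlc : ∀ t ∈ Ioc t₀ (t₀ + a), Tendsto g (𝓝[<] t) (𝓝 (g t)) := fun t ht =>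
    nhdsWithin_Ico_eq_nhdsLT ht.1 ▸ hg_lc t ht
  obtain ⟨F, hF⟩ := hM_int.exists_primitive
  choose H hH using fun u => (A1 u).exists_primitive
  have hbd : ∀ w u v, t₀ ≤ u → u ≤ v → v ≤ t₀ + a → ‖H w v - H w u‖ ≤ F v - F u :=
    fun w u v h1 h2 h3 => A2 w u v h1 h2 h3 _ _ (hH w u v h1 h2 h3) (hF u v h1 h2 h3)
  have hFm : MonotoneOn F (Icc t₀ (t₀ + a)) := fun u hu v hv huv =>
    sub_nonneg.1 ((norm_nonneg _).trans (hbd 0 u v hu.1 huv hv.2))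
  have hK : ∀ x : ℝ → En n, ∃ K : ℝ → En n, RegulatedOn x t₀ (t₀ + a) →
      IsVarPrimitive (fun s => f s (x s)) g K t₀ (t₀ + a) ∧
        ∀ u v, t₀ ≤ u → u ≤ v → v ≤ t₀ + a → ‖K v - K u‖ ≤ F v - F u := by
    intro x
    by_cases hx : RegulatedOn x t₀ (t₀ + a)
    · obtain ⟨K, h⟩ := exists_isVarPrimitive_superposition hab hg_mono hlc hFm A0
        (fun w => isVarPrimitive_of_hasKSIntegral hab (hH w)) hbd
        (x := x) fun t ht => nhdsWithin_Ico_eq_nhdsLT ht.1 ▸ hx.1 t ht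
      exact ⟨K, fun _ => h⟩
    · exact ⟨0, fun h => absurd h hx⟩
  choose K hK using hK
  have hinc : ∀ x : ℝ → En n, RegulatedOn x t₀ (t₀ + a) → ∀ u v, t₀ ≤ u → u ≤ v → v ≤ t₀ + a →
      ‖K x v - K x t₀ - (K x u - K x t₀)‖ ≤ F v - F u := fun x hx u v h1 h2 h3 => by
    rw [sub_sub_sub_cancel_right]
    exact (hK x hx).2 u v h1 h2 h3
  refine ⟨fun x t => K x t - K x t₀, fun x hx t ht => ?_, fun IM hIM x hx t ht => ?_, ?_,
    fun xs hxs _ => ?_⟩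
  · exact (hK x hx).1.hasKSIntegral le_rfl ht.1 ht.2
  · rw [hIM.unique hab (hF _ _ le_rfl hab le_rfl)]
    refine ((hK x hx).2 t₀ t le_rfl ht.1 ht.2).trans (sub_le_sub_right ?_ _)
    exact hFm ht (right_mem_Icc.2 hab) ht.2
  · refine equiregulatedOn_of_norm_sub_le hFm ?_
    rintro _ ⟨x, hx, rfl⟩
    exact hinc x hx
  · exact exists_subseq_tendstoUniformlyOn (y := fun k t => K (xs k) t - K (xs k) t₀) hab hFm
      (fun k => sub_self _) fun k => hinc _ (hxs k)

end HMDEPaper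
end

section
/- Let J = [t₀, t₀ + a] with a > 0. For each k ∈ ℕ let h_k : J × ℝⁿ → ℝⁿ be such that h_k(·,v) is regulated on J for every v ∈ ℝⁿ and there is a D-function φ_k with φ_k(t) < t for t > 0 and ‖h_k(t,u) − h_k(t,v)‖ ≤ φ_k(‖u − v‖) for all u, v ∈ ℝⁿ and t ∈ J. Assume that for every v ∈ ℝⁿ the sequence of functions (h_k(·,v))_k converges uniformly on J as k → ∞. Then for every bounded set K ⊆ ℝⁿ, the family of regulated functions {h_k(·,v) : v ∈ K, k ∈ ℕ} is equiregulated on J. -/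
open Set Filter Topology

namespace HMDEPaper

/-- A uniformly convergent sequence of functions, each Cauchy along `l`, has uniformly small
oscillation along `l`. -/
theorem exists_mem_forall_dist_lt_of_tendstoUniformlyOn {α β : Type*} [PseudoMetricSpace β]
    {l : Filter α} {S : Set α} (hS : S ∈ l) {f : ℕ → α → β} {g : α → β}
    (hf : ∀ k, Cauchy (map (f k) l)) (hfg : TendstoUniformlyOn f g atTop S)
    {ε : ℝ} (hε : 0 < ε) :
    ∃ U ∈ l, ∀ k, ∀ s ∈ U, ∀ t ∈ U, dist (f k s) (f k t) < ε := by
  have small : ∀ k, ∃ U ∈ l, ∀ s ∈ U, ∀ t ∈ U, dist (f k s) (f k t) < ε / 5 := by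
    intro k
    obtain ⟨V, hV, hVε⟩ := (Metric.cauchy_iff.1 (hf k)).2 (ε / 5) (by positivity)
    exact ⟨f k ⁻¹' V, hV, fun s hs t ht => hVε _ hs _ ht⟩
  choose U hU hUε using small
  obtain ⟨N, hN⟩ :=
    eventually_atTop.1 (Metric.tendstoUniformlyOn_iff.1 hfg (ε / 5) (by positivity))
  refine ⟨S ∩ ⋂ k ∈ Finset.range (N + 1), U k,
    inter_mem hS ((biInter_finset_mem _).2 fun k _ => hU k), ?_⟩
  rintro k s ⟨hsS, hsU⟩ t ⟨htS, htU⟩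
  simp only [mem_iInter, Finset.mem_range] at hsU htU
  rcases lt_or_ge k (N + 1) with hk | hk
  · linarith [hUε k s (hsU k hk) t (htU k hk)]
  · have hNU := hUε N s (hsU N N.lt_succ_self) t (htU N N.lt_succ_self)
    have hks := hN k (by omega) s hsS
    have hkt := hN k (by omega) t htS
    have hNs := hN N le_rfl s hsS
    have hNt := hN N le_rfl t htS
    have h₁ := dist_triangle4 (f k s) (g s) (g t) (f k t)
    have h₂ := dist_triangle4 (g s) (f N s) (f N t) (g t)
    rw [dist_comm (f k s) (g s)] at h₁
    rw [dist_comm (f N t) (g t)] at h₂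
    linarith

/-- For nonexpansive families, uniform smallness of the oscillation along `l` at each parameter
value is uniform over totally bounded sets of parameters. -/
theorem exists_mem_forall_dist_lt_of_totallyBounded {ι α β E : Type*} [PseudoMetricSpace β]
    [PseudoMetricSpace E] {l : Filter α} {S : Set α} (hS : S ∈ l) {h : ι → α → E → β}
    (hlip : ∀ k, ∀ t ∈ S, ∀ u v, dist (h k t u) (h k t v) ≤ dist u v)
    (hosc : ∀ v, ∀ ε > 0, ∃ U ∈ l, ∀ k, ∀ s ∈ U, ∀ t ∈ U, dist (h k s v) (h k t v) < ε)
    {K : Set E} (hK : TotallyBounded K) {ε : ℝ} (hε : 0 < ε) :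
    ∃ U ∈ l, ∀ v ∈ K, ∀ k, ∀ s ∈ U, ∀ t ∈ U, dist (h k s v) (h k t v) < ε := by
  obtain ⟨T, hT, hKT⟩ := Metric.totallyBounded_iff.1 hK (ε / 3) (by positivity)
  choose U hU hUε using fun v => hosc v (ε / 3) (by positivity)
  refine ⟨S ∩ ⋂ v ∈ T, U v, inter_mem hS ((biInter_mem hT).2 fun v _ => hU v), ?_⟩
  rintro v hv k s ⟨hsS, hsU⟩ t ⟨htS, htU⟩
  obtain ⟨w, hwT, hvw⟩ := mem_iUnion₂.1 (hKT hv)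
  rw [Metric.mem_ball] at hvw
  have h₁ := hlip k s hsS v w
  have h₂ := hlip k t htS w v
  rw [dist_comm w v] at h₂
  have h₃ := hUε w k s (mem_iInter₂.1 hsU w hwT) t (mem_iInter₂.1 htU w hwT)
  linarith [dist_triangle4 (h k s v) (h k s w) (h k t w) (h k t v)]

/-- A uniformly convergent sequence of nonexpansive families having limits within `A` at `τ`
approaches these limits uniformly over totally bounded sets of parameters. -/
theorem exists_forall_dist_lt_of_tendsto_nhdsWithin {α β E : Type*} [PseudoMetricSpace α]
    [PseudoMetricSpace β] [PseudoMetricSpace E] {A : Set α} {τ : α} [NeBot (𝓝[A] τ)]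
    {h : ℕ → α → E → β}
    (hlim : ∀ k v, ∃ L, Tendsto (fun t => h k t v) (𝓝[A] τ) (𝓝 L))
    (hlip : ∀ k, ∀ t ∈ A, ∀ u v, dist (h k t u) (h k t v) ≤ dist u v)
    (hconv : ∀ v, ∃ g : α → β, TendstoUniformlyOn (fun k t => h k t v) g atTop A)
    {K : Set E} (hK : TotallyBounded K) {ε : ℝ} (hε : 0 < ε) :
    ∃ δ > 0, ∀ v ∈ K, ∀ k L, Tendsto (fun t => h k t v) (𝓝[A] τ) (𝓝 L) →
      ∀ t ∈ A, dist t τ < δ → dist (h k t v) L < ε := by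
  have hosc : ∀ v, ∀ η > 0, ∃ U ∈ 𝓝[A] τ, ∀ k, ∀ s ∈ U, ∀ t ∈ U,
      dist (h k s v) (h k t v) < η := by
    intro v η hη
    obtain ⟨g, hg⟩ := hconv v
    exact exists_mem_forall_dist_lt_of_tendstoUniformlyOn self_mem_nhdsWithin
      (fun k => (hlim k v).choose_spec.cauchy_map) hg hη
  obtain ⟨U, hU, hUε⟩ := exists_mem_forall_dist_lt_of_totallyBounded self_mem_nhdsWithin
    hlip hosc hK (half_pos hε)
  obtain ⟨δ, hδ, hδU⟩ := Metric.mem_nhdsWithin_iff.1 hU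
  refine ⟨δ, hδ, fun v hv k L hL t htA htδ => ?_⟩
  have hle : dist (h k t v) L ≤ ε / 2 := by
    refine le_of_tendsto (tendsto_const_nhds.dist hL) ?_
    filter_upwards [hU] with s hs
    exact (hUε v hv k t (hδU ⟨htδ, htA⟩) s hs).le
  linarith

/-- Step 2 in the proof of Theorem 5.1: a uniformly convergent sequence of
`D`-contractive families `h_k(·, v)` is equiregulated, uniformly for `v` in a bounded set. -/
theorem equiregulated_family_of_contractions
    {n : ℕ} (t₀ a : ℝ) (ha : 0 < a)
    (h : ℕ → ℝ → En n → En n) (φ : ℕ → ℝ → ℝ)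
    (hreg : ∀ k : ℕ, ∀ v : En n, RegulatedOn (fun t => h k t v) t₀ (t₀ + a))
    (hφD : ∀ k : ℕ, IsDFunction (φ k))
    (hφlt : ∀ k : ℕ, ∀ t : ℝ, 0 < t → φ k t < t)
    (hlip : ∀ k : ℕ, ∀ t ∈ Set.Icc t₀ (t₀ + a), ∀ u v : En n,
      ‖h k t u - h k t v‖ ≤ φ k ‖u - v‖)
    (hconv : ∀ v : En n, ∃ hv : ℝ → En n,
      TendstoUniformlyOn (fun k t => h k t v) hv Filter.atTop (Set.Icc t₀ (t₀ + a)))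
    (K : Set (En n)) (hK : Bornology.IsBounded K) :
    EquiregulatedOn
      {y : ℝ → En n | ∃ v ∈ K, ∃ k : ℕ, y = fun t => h k t v} t₀ (t₀ + a) := by
  have hnonexp : ∀ k, ∀ t ∈ Icc t₀ (t₀ + a), ∀ u v : En n,
      dist (h k t u) (h k t v) ≤ dist u v := by
    intro k t ht u v
    rw [dist_eq_norm, dist_eq_norm]
    refine (hlip k t ht u v).trans ?_
    rcases (norm_nonneg (u - v)).eq_or_lt with h0 | hpos
    · rw [← h0, (hφD k).2.2.1]
    · exact (hφlt k _ hpos).le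
  have hKtb : TotallyBounded K := hK.isCompact_closure.totallyBounded.subset subset_closure
  intro ε hε
  refine ⟨fun τ hτ => ?_, fun τ hτ => ?_⟩
  · have hA : Ico t₀ τ ⊆ Icc t₀ (t₀ + a) := fun t ht => ⟨ht.1, ht.2.le.trans hτ.2⟩
    have : NeBot (𝓝[Ico t₀ τ] τ) := by
      rw [nhdsWithin_Ico_eq_nhdsLT hτ.1]
      infer_instance
    obtain ⟨δ, hδ, H⟩ := exists_forall_dist_lt_of_tendsto_nhdsWithin
      (fun k v => (hreg k v).1 τ hτ) (fun k t ht => hnonexp k t (hA ht))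
      (fun v => (hconv v).imp fun _ hg => hg.mono hA) hKtb hε
    refine ⟨δ, hδ, ?_⟩
    rintro _ ⟨v, hv, k, rfl⟩ L hL t ht htδ
    rw [← dist_eq_norm]
    refine H v hv k L hL t ht ?_
    rw [Real.dist_eq, abs_lt]
    constructor <;> linarith [ht.2]
  · have hA : Ioc τ (t₀ + a) ⊆ Icc t₀ (t₀ + a) := fun t ht => ⟨hτ.1.trans ht.1.le, ht.2⟩
    have : NeBot (𝓝[Ioc τ (t₀ + a)] τ) := by
      rw [nhdsWithin_Ioc_eq_nhdsGT hτ.2]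
      infer_instance
    obtain ⟨δ, hδ, H⟩ := exists_forall_dist_lt_of_tendsto_nhdsWithin
      (fun k v => (hreg k v).2 τ hτ) (fun k t ht => hnonexp k t (hA ht))
      (fun v => (hconv v).imp fun _ hg => hg.mono hA) hKtb hε
    refine ⟨δ, hδ, ?_⟩
    rintro _ ⟨v, hv, k, rfl⟩ L hL t ht htδ
    rw [← dist_eq_norm]
    refine H v hv k L hL t ht ?_
    rw [Real.dist_eq, abs_lt]
    constructor <;> linarith [ht.1]

end HMDEPaper
end
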